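/- (Freitas–Henrot inequality.) Let d ≥ 2, let Ω ⊆ ℝ^d be open, bounded and nonempty, and let B^∧, B^∨ ⊂ ℝ^d be any two disjoint open balls of equal radius. Then |Ω|^{2/d} λ₁^{𝟙}(Ω) ≥ |B^∧ ∪ B^∨|^{2/d} λ₁^{𝟙}(B^∧ ∪ B^∨), where 𝟙 denotes the constant function identically equal to 1, so that λ₁^{𝟙} is the first standard twisted eigenvalue λ₁^T. -/

import Mathlib

open MeasureTheory Metric Set Filter

open scoped Classical ENNReal

noncomputable section

/-- The Rayleigh quotient of `u : ℝ^d → ℝ`. -/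
def rayleigh (d : ℕ) (u : EuclideanSpace ℝ (Fin d) → ℝ) : ℝ :=
  (∫ x, ‖gradient u x‖ ^ 2) / (∫ x, (u x) ^ 2)

/-- A trial function for the Dirichlet eigenvalue on `Ω`: Lipschitz, vanishing outside `Ω`,
and not almost everywhere zero. -/
def IsDirTrial (d : ℕ) (Ω : Set (EuclideanSpace ℝ (Fin d)))
    (u : EuclideanSpace ℝ (Fin d) → ℝ) : Prop :=
  (∃ K, LipschitzWith K u) ∧ (∀ x ∉ Ω, u x = 0) ∧ ¬ (u =ᵐ[volume] fun _ => (0 : ℝ))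

/-- The first Dirichlet eigenvalue of `Ω`. -/
def dirichletEV (d : ℕ) (Ω : Set (EuclideanSpace ℝ (Fin d))) : ℝ :=
  sInf { r | ∃ u, IsDirTrial d Ω u ∧ rayleigh d u = r }

/-- The first twisted eigenvalue of `Ω` with orthogonality constraint `g`. -/
def twistedEV (d : ℕ) (Ω : Set (EuclideanSpace ℝ (Fin d)))
    (g : EuclideanSpace ℝ (Fin d) → ℝ) : ℝ :=
  sInf { r | ∃ u, IsDirTrial d Ω u ∧ (∫ x, u x * g x) = 0 ∧ rayleigh d u = r }

/-- `u` is a minimizer for the first twisted eigenvalue `λ₁^g(Ω)`. -/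
def IsTwistedMin (d : ℕ) (Ω : Set (EuclideanSpace ℝ (Fin d)))
    (g u : EuclideanSpace ℝ (Fin d) → ℝ) : Prop :=
  IsDirTrial d Ω u ∧ (∫ x, u x * g x) = 0 ∧ rayleigh d u = twistedEV d Ω g

/-- The bang-bang function equal to `1` on `Bm` and `α` elsewhere. -/
def chiBang (d : ℕ) (α : ℝ) (Bm : Set (EuclideanSpace ℝ (Fin d))) :
    EuclideanSpace ℝ (Fin d) → ℝ :=
  fun x => if x ∈ Bm then 1 else α

theorem MeasurableSet.measure_eq_iSup_subtype_isCompact {A : Set ℝ} (hA : MeasurableSet A) :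
    volume A = ⨆ K : {K : Set ℝ // K ⊆ A ∧ IsCompact K}, volume K.1 := by
  rw [hA.measure_eq_iSup_isCompact, iSup_subtype]
  simp only [iSup_and]

open scoped Pointwise in
/-- The one-dimensional Brunn-Minkowski inequality for compact sets. -/
theorem IsCompact.volume_add_volume_le {K L C : Set ℝ} (hK : IsCompact K) (hL : IsCompact L)
    (hKn : K.Nonempty) (hLn : L.Nonempty) {s : ℝ} (hs : 0 < s) (hs1 : s < 1)
    (h : ∀ a ∈ K, ∀ b ∈ L, (1 - s) * a + s * b ∈ C) :
    ENNReal.ofReal (1 - s) * volume K + ENNReal.ofReal s * volume L ≤ volume C := by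
  obtain ⟨a, haK, ha⟩ := hK.exists_isGreatest hKn
  obtain ⟨b, hbL, hb⟩ := hL.exists_isLeast hLn
  have hvol : ∀ (t c : ℝ) (S : Set ℝ), 0 < t →
      volume ((fun x => c + t * x) '' S) = ENNReal.ofReal t * volume S := by
    intro t c S ht
    have : (fun x => c + t * x) '' S = c +ᵥ (t • S) := by
      ext x; simp [mem_vadd_set, mem_smul_set]
    rw [this, measure_vadd, Measure.addHaar_smul]
    simp [abs_of_pos ht]
  rw [← hvol (1 - s) (s * b) K (by linarith), ← hvol s ((1 - s) * a) L hs]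
  have hLc : IsCompact ((fun x => (1 - s) * a + s * x) '' L) := hL.image (by fun_prop)
  rw [← measure_union₀ hLc.measurableSet.nullMeasurableSet]
  · apply measure_mono
    rintro _ (⟨x, hx, rfl⟩ | ⟨x, hx, rfl⟩)
    · have := h x hx b hbL
      simpa [add_comm] using this
    · exact h a haK x hx
  · refine measure_mono_null (t := {(1 - s) * a + s * b}) ?_ (by simp)
    rintro _ ⟨⟨x, hx, rfl⟩, ⟨y, hy, hxy⟩⟩
    have h1 : x ≤ a := ha hx
    have h2 : b ≤ y := hb hy
    have h3 : (1 - s) * x ≤ (1 - s) * a := mul_le_mul_of_nonneg_left h1 (by linarith)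
    have h4 : s * b ≤ s * y := mul_le_mul_of_nonneg_left h2 hs.le
    simp only [mem_singleton_iff] at *
    linarith

/-- The one-dimensional Brunn-Minkowski inequality. -/
theorem MeasurableSet.volume_add_volume_le {A B C : Set ℝ} (hA : MeasurableSet A)
    (hB : MeasurableSet B) (hAn : A.Nonempty) (hBn : B.Nonempty) {s : ℝ} (hs : 0 < s)
    (hs1 : s < 1) (h : ∀ a ∈ A, ∀ b ∈ B, (1 - s) * a + s * b ∈ C) :
    ENNReal.ofReal (1 - s) * volume A + ENNReal.ofReal s * volume B ≤ volume C := by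
  obtain ⟨a, ha⟩ := hAn
  obtain ⟨b, hb⟩ := hBn
  have : Nonempty {K : Set ℝ // K ⊆ A ∧ IsCompact K} := ⟨⟨∅, by simp⟩⟩
  have : Nonempty {K : Set ℝ // K ⊆ B ∧ IsCompact K} := ⟨⟨∅, by simp⟩⟩
  rw [hA.measure_eq_iSup_subtype_isCompact, hB.measure_eq_iSup_subtype_isCompact,
    ENNReal.mul_iSup, ENNReal.mul_iSup, ENNReal.iSup_add]
  refine iSup_le fun K => ?_
  rw [ENNReal.add_iSup]
  refine iSup_le fun L => ?_
  have := (K.2.2.insert a).volume_add_volume_le (L.2.2.insert b) (insert_nonempty _ _)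
    (insert_nonempty _ _) hs hs1 (C := C) (fun x hx y hy =>
      h x (insert_subset ha K.2.1 hx) y (insert_subset hb L.2.1 hy))
  refine le_trans ?_ this
  gcongr <;> exact subset_insert _ _

theorem lintegral_ofReal_eq_lintegral_Ioo {f : ℝ → ℝ} (hf : Measurable f) (hf0 : ∀ x, 0 ≤ f x)
    (hf1 : ∀ x, f x ≤ 1) :
    ∫⁻ x, ENNReal.ofReal (f x) = ∫⁻ t in Ioo (0 : ℝ) 1, volume {x | t < f x} := by
  rw [lintegral_eq_lintegral_meas_lt volume (ae_of_all _ hf0) hf.aemeasurable]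
  rw [← lintegral_indicator measurableSet_Ioi, ← lintegral_indicator measurableSet_Ioo]
  refine lintegral_congr fun t => ?_
  by_cases ht : t ∈ Ioo (0 : ℝ) 1
  · rw [indicator_of_mem ht, indicator_of_mem (Ioo_subset_Ioi_self ht)]
  · rw [indicator_of_notMem ht]
    refine indicator_apply_eq_zero.2 fun ht0 => ?_
    have h1 : 1 ≤ t := not_lt.mp fun hlt => ht ⟨ht0, hlt⟩
    have : {x | t < f x} = ∅ := by
      ext x; simpa using (hf1 x).trans h1
    simp [this]

/-- Prékopa-Leindler on the line for functions of supremum one, in arithmetic-mean form. -/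
theorem lintegral_add_lintegral_le_of_sup_eq_one {f g h : ℝ → ℝ} (hf : Measurable f)
    (hg : Measurable g) (hh : Measurable h)
    (hf0 : ∀ x, 0 ≤ f x) (hg0 : ∀ x, 0 ≤ g x) (hh0 : ∀ x, 0 ≤ h x)
    (hf1 : ∀ x, f x ≤ 1) (hg1 : ∀ x, g x ≤ 1) (hh1 : ∀ x, h x ≤ 1)
    (hfs : ∀ t < 1, ∃ x, t < f x) (hgs : ∀ t < 1, ∃ x, t < g x)
    {s : ℝ} (hs : 0 < s) (hs1 : s < 1)
    (hfg : ∀ x y, min (f x) (g y) ≤ h ((1 - s) * x + s * y)) :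
    ENNReal.ofReal (1 - s) * (∫⁻ x, ENNReal.ofReal (f x)) +
      ENNReal.ofReal s * (∫⁻ x, ENNReal.ofReal (g x)) ≤ ∫⁻ x, ENNReal.ofReal (h x) := by
  have hanti : ∀ k : ℝ → ℝ, Measurable fun t : ℝ => volume {x | t < k x} := fun k =>
    Antitone.measurable fun a b hab => measure_mono fun x (hx : b < k x) => hab.trans_lt hx
  rw [lintegral_ofReal_eq_lintegral_Ioo hf hf0 hf1, lintegral_ofReal_eq_lintegral_Ioo hg hg0 hg1,
    lintegral_ofReal_eq_lintegral_Ioo hh hh0 hh1, ← lintegral_const_mul _ (hanti f),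
    ← lintegral_const_mul _ (hanti g), ← lintegral_add_left ((hanti f).const_mul _)]
  refine setLIntegral_mono (hanti h) fun t ht => ?_
  refine (measurableSet_lt measurable_const hf).volume_add_volume_le
    (measurableSet_lt measurable_const hg) (hfs t ht.2) (hgs t ht.2) hs hs1 fun a ha b hb => ?_
  exact (lt_min ha hb).trans_le (hfg a b)

theorem ENNReal.rpow_mul_rpow_le_add {a b : ℝ≥0∞} {s : ℝ} (hs : 0 < s) (hs1 : s < 1) :
    a ^ (1 - s) * b ^ s ≤ ENNReal.ofReal (1 - s) * a + ENNReal.ofReal s * b := by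
  have hs' : 0 < 1 - s := by linarith
  have hpq : (1 - s)⁻¹.HolderConjugate s⁻¹ := by
    rw [Real.holderConjugate_iff]
    refine ⟨(one_lt_inv₀ hs').2 (by linarith), by simp⟩
  have := ENNReal.young_inequality (a ^ (1 - s)) (b ^ s) hpq
  rw [← ENNReal.rpow_mul, ← ENNReal.rpow_mul, mul_inv_cancel₀ hs'.ne', mul_inv_cancel₀ hs.ne',
    ENNReal.rpow_one, ENNReal.rpow_one, ENNReal.ofReal_inv_of_pos hs',
    ENNReal.ofReal_inv_of_pos hs, div_eq_mul_inv, div_eq_mul_inv, inv_inv, inv_inv] at this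
  rwa [mul_comm _ a, mul_comm _ b]

theorem ENNReal.min_le_rpow_mul_rpow {a b : ℝ≥0∞} {s : ℝ} (hs : 0 < s) (hs1 : s < 1) :
    min a b ≤ a ^ (1 - s) * b ^ s := by
  calc min a b = (min a b) ^ (1 - s) * (min a b) ^ s := by
        rw [← ENNReal.rpow_add_of_nonneg _ _ (by linarith) hs.le]; simp
    _ ≤ a ^ (1 - s) * b ^ s := by
        have : 0 ≤ 1 - s := by linarith
        gcongr
        · exact min_le_left _ _
        · exact min_le_right _ _

theorem ENNReal.div_rpow_mul_div_rpow {a b M N : ℝ≥0∞} {s : ℝ} (hs : 0 < s) (hs1 : s < 1)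
    (hM : M ≠ ∞) (hN : N ≠ ∞) :
    (a / M) ^ (1 - s) * (b / N) ^ s = (a ^ (1 - s) * b ^ s) / (M ^ (1 - s) * N ^ s) := by
  have : 0 ≤ 1 - s := by linarith
  rw [ENNReal.div_rpow_of_nonneg _ _ this, ENNReal.div_rpow_of_nonneg _ _ hs.le]
  simp only [div_eq_mul_inv]
  rw [ENNReal.mul_inv (Or.inr (ENNReal.rpow_ne_top_of_nonneg hs.le hN))
    (Or.inl (ENNReal.rpow_ne_top_of_nonneg this hM))]
  ring

/-- Prékopa-Leindler on the line for bounded functions. -/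
theorem prekopaLeindler_real_of_bounded {f g h : ℝ → ℝ≥0∞} (hf : Measurable f)
    (hg : Measurable g) (hh : Measurable h) (hfM : ⨆ x, f x ≠ ∞) (hgM : ⨆ x, g x ≠ ∞)
    {s : ℝ} (hs : 0 < s) (hs1 : s < 1)
    (hfg : ∀ x y, f x ^ (1 - s) * g y ^ s ≤ h ((1 - s) * x + s * y)) :
    (∫⁻ x, f x) ^ (1 - s) * (∫⁻ x, g x) ^ s ≤ ∫⁻ x, h x := by
  have hs' : 0 < 1 - s := by linarith
  set M := ⨆ x, f x with hM
  set N := ⨆ x, g x with hN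
  rcases eq_or_ne M 0 with h0 | hM0
  · have : ∀ x, f x = 0 := fun x => by simpa [h0] using (le_iSup f x).trans_eq hM.symm
    simp [this, hs']
  rcases eq_or_ne N 0 with h0 | hN0
  · have : ∀ x, g x = 0 := fun x => by simpa [h0] using (le_iSup g x).trans_eq hN.symm
    simp [this, hs]
  set P := M ^ (1 - s) * N ^ s with hP
  have hP0 : P ≠ 0 := mul_ne_zero (by simp [hM0, hfM]) (by simp [hN0, hgM])
  have hPt : P ≠ ∞ := ENNReal.mul_ne_top (ENNReal.rpow_ne_top_of_nonneg hs'.le hfM)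
    (ENNReal.rpow_ne_top_of_nonneg hs.le hgM)
  have hf1 : ∀ x, f x / M ≤ 1 := fun x => ENNReal.div_le_of_le_mul (by simpa using le_iSup f x)
  have hg1 : ∀ x, g x / N ≤ 1 := fun x => ENNReal.div_le_of_le_mul (by simpa using le_iSup g x)
  have hne : ∀ {a : ℝ≥0∞}, a ≤ 1 → a ≠ ∞ := fun h => ne_top_of_le_ne_top ENNReal.one_ne_top h
  have hsup : ∀ (k : ℝ → ℝ≥0∞), ⨆ x, k x ≠ ∞ → ⨆ x, k x ≠ 0 → ∀ t < 1,
      ∃ x, t < (k x / ⨆ x, k x).toReal := by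
    intro k hk hk0 t ht
    have h1 : ENNReal.ofReal t * (⨆ x, k x) < ⨆ x, k x := by
      conv_rhs => rw [← one_mul (⨆ x, k x)]
      exact ENNReal.mul_lt_mul_left hk0 hk (by simpa using ht)
    obtain ⟨x, hx⟩ := lt_iSup_iff.1 h1
    refine ⟨x, ?_⟩
    rw [← ENNReal.lt_div_iff_mul_lt (Or.inl hk0) (Or.inl hk)] at hx
    by_contra hle
    refine hx.not_ge ((ENNReal.le_ofReal_iff_toReal_le (hne ?_) ?_).2 (not_lt.mp hle))
    · exact ENNReal.div_le_of_le_mul (by simpa using le_iSup k x)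
    · exact ENNReal.toReal_nonneg.trans (not_lt.mp hle)
  have key := lintegral_add_lintegral_le_of_sup_eq_one (f := fun x => (f x / M).toReal)
    (g := fun x => (g x / N).toReal) (h := fun x => (min (h x / P) 1).toReal)
    (by fun_prop) (by fun_prop) (by fun_prop) (fun _ => ENNReal.toReal_nonneg)
    (fun _ => ENNReal.toReal_nonneg) (fun _ => ENNReal.toReal_nonneg)
    (fun x => ENNReal.toReal_le_of_le_ofReal zero_le_one (by simpa using hf1 x))
    (fun x => ENNReal.toReal_le_of_le_ofReal zero_le_one (by simpa using hg1 x))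
    (fun x => ENNReal.toReal_le_of_le_ofReal zero_le_one (by simp))
    (hsup f hfM hM0) (hsup g hgM hN0) hs hs1 (by
      intro x y
      rw [← ENNReal.toReal_min (hne (hf1 x)) (hne (hg1 y))]
      refine ENNReal.toReal_mono (hne (min_le_right _ _)) (le_min ?_ ?_)
      · refine (ENNReal.min_le_rpow_mul_rpow hs hs1).trans ?_
        rw [ENNReal.div_rpow_mul_div_rpow hs hs1 hfM hgM]
        exact ENNReal.div_le_div_right (hfg x y) _
      · exact (min_le_left _ _).trans (hf1 x))
  simp only [ENNReal.ofReal_toReal (hne (hf1 _)), ENNReal.ofReal_toReal (hne (hg1 _)),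
    ENNReal.ofReal_toReal (hne (min_le_right _ _))] at key
  have key2 := (ENNReal.rpow_mul_rpow_le_add hs hs1).trans
    (key.trans (lintegral_mono fun x => min_le_left (h x / P) 1))
  simp only [div_eq_mul_inv] at key2
  rw [lintegral_mul_const _ hf, lintegral_mul_const _ hg, lintegral_mul_const _ hh] at key2
  simp only [← div_eq_mul_inv] at key2
  rw [ENNReal.div_rpow_mul_div_rpow hs hs1 hfM hgM] at key2
  exact by
    have := mul_le_mul_left key2 P
    rwa [← hP, ENNReal.div_mul_cancel hP0 hPt, ENNReal.div_mul_cancel hP0 hPt] at this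

/-- Prékopa-Leindler on the line. -/
theorem prekopaLeindler_real {f g h : ℝ → ℝ≥0∞} (hf : Measurable f)
    (hg : Measurable g) (hh : Measurable h) {s : ℝ} (hs : 0 < s) (hs1 : s < 1)
    (hfg : ∀ x y, f x ^ (1 - s) * g y ^ s ≤ h ((1 - s) * x + s * y)) :
    (∫⁻ x, f x) ^ (1 - s) * (∫⁻ x, g x) ^ s ≤ ∫⁻ x, h x := by
  have hs' : 0 < 1 - s := by linarith
  have hlim : ∀ {k : ℝ → ℝ≥0∞}, Measurable k →
      Tendsto (fun n : ℕ => ∫⁻ x, min (k x) n) atTop (nhds (∫⁻ x, k x)) := by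
    intro k hk
    refine lintegral_tendsto_of_tendsto_of_monotone (fun n => by fun_prop)
      (ae_of_all _ fun x a b hab => by dsimp only; gcongr) (ae_of_all _ fun x => ?_)
    have := (tendsto_const_nhds (x := k x)).min ENNReal.tendsto_nat_nhds_top
    simpa using this
  have hbd : ∀ (k : ℝ → ℝ≥0∞) (n : ℕ), ⨆ x, min (k x) n ≠ ∞ := fun k n =>
    ne_top_of_le_ne_top (ENNReal.natCast_ne_top n) (iSup_le fun x => min_le_right _ _)
  have key : ∀ n : ℕ, (∫⁻ x, min (f x) n) ^ (1 - s) * (∫⁻ x, min (g x) n) ^ s ≤ ∫⁻ x, h x := by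
    intro n
    refine prekopaLeindler_real_of_bounded (by fun_prop) (by fun_prop) hh (hbd f n) (hbd g n)
      hs hs1 fun x y => le_trans ?_ (hfg x y)
    gcongr <;> exact min_le_left _ _
  rcases eq_or_ne ((∫⁻ x, f x) ^ (1 - s)) 0 with hF | hF
  · simp [hF]
  rcases eq_or_ne ((∫⁻ x, g x) ^ s) 0 with hG | hG
  · simp [hG]
  exact le_of_tendsto' (ENNReal.Tendsto.mul ((hlim hf).ennrpow_const _) (Or.inl hF)
    ((hlim hg).ennrpow_const _) (Or.inl hG)) key

theorem prekopaLeindler {n : ℕ} {f g h : (Fin n → ℝ) → ℝ≥0∞} (hf : Measurable f)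
    (hg : Measurable g) (hh : Measurable h) {s : ℝ} (hs : 0 < s) (hs1 : s < 1)
    (hfg : ∀ x y, f x ^ (1 - s) * g y ^ s ≤ h ((1 - s) • x + s • y)) :
    (∫⁻ x, f x) ^ (1 - s) * (∫⁻ x, g x) ^ s ≤ ∫⁻ x, h x := by
  induction n with
  | zero =>
    have hint : ∀ k : (Fin 0 → ℝ) → ℝ≥0∞, ∫⁻ x, k x = k default := fun k => by
      rw [lintegral_unique, volume_pi]
      simpa using congrArg k (Subsingleton.elim _ _)
    rw [hint, hint, hint]
    exact (hfg default default).trans_eq (congrArg h (Subsingleton.elim _ _))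
  | succ n ih =>
    have hcons : ∀ p : ℝ × (Fin n → ℝ),
        (MeasurableEquiv.piFinSuccAbove (fun _ : Fin (n + 1) => ℝ) 0).symm p =
          Fin.cons p.1 p.2 := fun p => by
      ext i
      refine Fin.cases ?_ (fun i => ?_) i <;> simp [MeasurableEquiv.piFinSuccAbove]
    have hsplit : ∀ {k : (Fin (n + 1) → ℝ) → ℝ≥0∞}, Measurable k →
        ∫⁻ x, k x = ∫⁻ a : ℝ, ∫⁻ y : Fin n → ℝ, k (Fin.cons a y) := by
      intro k hk
      rw [← (volume_preserving_piFinSuccAbove (fun _ : Fin (n + 1) => ℝ) 0).symm.lintegral_comp hk]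
      rw [Measure.volume_eq_prod, lintegral_prod _ (by fun_prop)]
      simp only [hcons]
    have hmeas : ∀ {k : (Fin (n + 1) → ℝ) → ℝ≥0∞}, Measurable k →
        Measurable fun p : ℝ × (Fin n → ℝ) => k (Fin.cons p.1 p.2) := by
      intro k hk
      have := (MeasurableEquiv.piFinSuccAbove (fun _ : Fin (n + 1) => ℝ) 0).symm.measurable
      have h2 := hk.comp this
      simpa only [Function.comp_def, hcons] using h2
    rw [hsplit hf, hsplit hg, hsplit hh]
    refine prekopaLeindler_real (hmeas hf).lintegral_prod_right' (hmeas hg).lintegral_prod_right'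
      (hmeas hh).lintegral_prod_right' hs hs1 fun a b => ?_
    refine ih (by have := hmeas hf; fun_prop) (by have := hmeas hg; fun_prop)
       (by have := hmeas hh; fun_prop) fun x y => (hfg _ _).trans_eq ?_
    congr 1
    ext i
    refine Fin.cases ?_ (fun i => ?_) i <;> simp

theorem prekopaLeindler_euclideanSpace {d : ℕ} {f g h : EuclideanSpace ℝ (Fin d) → ℝ≥0∞}
    (hf : Measurable f) (hg : Measurable g) (hh : Measurable h) {s : ℝ} (hs : 0 < s) (hs1 : s < 1)
    (hfg : ∀ x y, f x ^ (1 - s) * g y ^ s ≤ h ((1 - s) • x + s • y)) :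
    (∫⁻ x, f x) ^ (1 - s) * (∫⁻ x, g x) ^ s ≤ ∫⁻ x, h x := by
  have hm := PiLp.volume_preserving_toLp (Fin d)
  rw [← hm.lintegral_comp hf, ← hm.lintegral_comp hg, ← hm.lintegral_comp hh]
  exact prekopaLeindler (hf.comp hm.measurable) (hg.comp hm.measurable) (hh.comp hm.measurable)
    hs hs1 fun x y => hfg _ _

theorem preimage_smul_ball_zero {E : Type*} [NormedAddCommGroup E] [NormedSpace ℝ E] {c : ℝ}
    (hc : 0 < c) (τ : ℝ) : (fun x : E => c • x) ⁻¹' ball 0 τ = ball 0 (τ / c) := by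
  ext x
  simp [norm_smul, abs_of_pos hc, lt_div_iff₀' hc]

/-- The Brunn-Minkowski inequality for an open set and a ball. -/
theorem IsOpen.volume_ball_add_le_volume_thickening {d : ℕ} {A : Set (EuclideanSpace ℝ (Fin d))}
    (hA : IsOpen A) {ρ τ : ℝ} (hρ : 0 < ρ) (hτ : 0 < τ)
    (h : volume (ball (0 : EuclideanSpace ℝ (Fin d)) ρ) ≤ volume A) :
    volume (ball (0 : EuclideanSpace ℝ (Fin d)) (ρ + τ)) ≤ volume (thickening τ A) := by
  have hsum : 0 < ρ + τ := by positivity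
  set s := τ / (ρ + τ) with hsdef
  have hs : 0 < s := by positivity
  have hs1' : 1 - s = ρ / (ρ + τ) := by rw [hsdef]; field_simp; ring
  have hs1 : 0 < 1 - s := by rw [hs1']; positivity
  have hmA : Measurable fun x : EuclideanSpace ℝ (Fin d) => (1 - s) • x := by fun_prop
  have hmB : Measurable fun x : EuclideanSpace ℝ (Fin d) => s • x := by fun_prop
  have hA' : MeasurableSet ((fun x => (1 - s) • x) ⁻¹' A) := hmA hA.measurableSet
  have hB' : MeasurableSet ((fun x => s • x) ⁻¹' ball (0 : EuclideanSpace ℝ (Fin d)) τ) :=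
    hmB measurableSet_ball
  have key := prekopaLeindler_euclideanSpace (d := d)
    (f := ((fun x => (1 - s) • x) ⁻¹' A).indicator 1)
    (g := ((fun x => s • x) ⁻¹' ball 0 τ).indicator 1)
    (h := (thickening τ A).indicator 1)
    (measurable_one.indicator hA') (measurable_one.indicator hB')
    (measurable_one.indicator isOpen_thickening.measurableSet) hs (by linarith) (by
      intro x y
      by_cases hx : (1 - s) • x ∈ A
      swap
      · simp [indicator, hx, hs1]
      by_cases hy : s • y ∈ ball (0 : EuclideanSpace ℝ (Fin d)) τ
      swap
      · have hy' := hy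
        rw [mem_ball_zero_iff] at hy'
        simp [indicator, hy', hs]
      have : (1 - s) • x + s • y ∈ thickening τ A := by
        rw [mem_thickening_iff]
        exact ⟨_, hx, by simpa using hy⟩
      rw [indicator_of_mem (mem_preimage.2 hx), indicator_of_mem (mem_preimage.2 hy),
        indicator_of_mem this]
      simp)
  rw [lintegral_indicator_one hA', lintegral_indicator_one hB',
    lintegral_indicator_one isOpen_thickening.measurableSet] at key
  have e1 : volume (ball (0 : EuclideanSpace ℝ (Fin d)) (ρ + τ)) ≤
      volume ((fun x => (1 - s) • x) ⁻¹' A) := by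
    have : ρ + τ = ρ / (1 - s) := by rw [hs1']; field_simp
    rw [this, ← preimage_smul_ball_zero hs1, Measure.addHaar_preimage_smul _ hs1.ne',
      Measure.addHaar_preimage_smul _ hs1.ne']
    gcongr
  have e2 : volume (ball (0 : EuclideanSpace ℝ (Fin d)) (ρ + τ)) =
      volume ((fun x => s • x) ⁻¹' ball (0 : EuclideanSpace ℝ (Fin d)) τ) := by
    rw [preimage_smul_ball_zero hs]
    congr 2
    rw [hsdef]; field_simp
  rw [← e2] at key
  refine le_trans ?_ key
  calc volume (ball (0 : EuclideanSpace ℝ (Fin d)) (ρ + τ))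
      = volume (ball (0 : EuclideanSpace ℝ (Fin d)) (ρ + τ)) ^ (1 - s) *
        volume (ball (0 : EuclideanSpace ℝ (Fin d)) (ρ + τ)) ^ s := by
        rw [← ENNReal.rpow_add_of_nonneg _ _ hs1.le hs.le]; simp
    _ ≤ _ := by gcongr

section SupConvolution

variable {E : Type*} [NormedAddCommGroup E]

/-- The quadratic sup-convolution (Hopf-Lax evolution) of `u` at time `ε`. -/
def supConv (ε : ℝ) (u : E → ℝ) (x : E) : ℝ := ⨆ y, (u y - ‖y - x‖ ^ 2 / (2 * ε))

variable {u : E → ℝ} {K : NNReal} {ε : ℝ}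

theorem LipschitzWith.le_add_mul_norm_sub (hu : LipschitzWith K u) (x y : E) :
    u y ≤ u x + K * ‖y - x‖ := by
  have := (le_abs_self _).trans (hu.dist_le_mul y x)
  rw [dist_eq_norm] at this
  linarith

theorem mul_sub_sq_div_le (hε : 0 < ε) (a r : ℝ) : a * r - r ^ 2 / (2 * ε) ≤ ε * a ^ 2 / 2 := by
  have : ε * a ^ 2 / 2 - (a * r - r ^ 2 / (2 * ε)) = (ε * a - r) ^ 2 / (2 * ε) := by
    field_simp; ring
  have h2 : 0 ≤ (ε * a - r) ^ 2 / (2 * ε) := by positivity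
  linarith

theorem LipschitzWith.sub_sq_div_le (hu : LipschitzWith K u) (hε : 0 < ε) (x y : E) :
    u y - ‖y - x‖ ^ 2 / (2 * ε) ≤ u x + ε * K ^ 2 / 2 := by
  have h1 := hu.le_add_mul_norm_sub x y
  have h2 := mul_sub_sq_div_le hε K ‖y - x‖
  linarith

theorem LipschitzWith.bddAbove_supConv (hu : LipschitzWith K u) (hε : 0 < ε) (x : E) :
    BddAbove (range fun y => u y - ‖y - x‖ ^ 2 / (2 * ε)) :=
  ⟨_, forall_mem_range.2 (hu.sub_sq_div_le hε x)⟩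

theorem LipschitzWith.supConv_le (hu : LipschitzWith K u) (hε : 0 < ε) (x : E) :
    supConv ε u x ≤ u x + ε * K ^ 2 / 2 :=
  ciSup_le (hu.sub_sq_div_le hε x)

theorem LipschitzWith.sub_le_supConv (hu : LipschitzWith K u) (hε : 0 < ε) (x y : E) :
    u y - ‖y - x‖ ^ 2 / (2 * ε) ≤ supConv ε u x :=
  le_ciSup (hu.bddAbove_supConv hε x) y

theorem LipschitzWith.le_supConv (hu : LipschitzWith K u) (hε : 0 < ε) (x : E) :
    u x ≤ supConv ε u x := by
  simpa using hu.sub_le_supConv hε x x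

theorem LipschitzWith.lt_supConv_iff (hu : LipschitzWith K u) (hε : 0 < ε) (x : E) (t : ℝ) :
    t < supConv ε u x ↔ ∃ y, t < u y - ‖y - x‖ ^ 2 / (2 * ε) :=
  lt_ciSup_iff (hu.bddAbove_supConv hε x)

theorem LipschitzWith.isOpen_lt_supConv (hu : LipschitzWith K u) (hε : 0 < ε) (t : ℝ) :
    IsOpen {x | t < supConv ε u x} := by
  simp only [hu.lt_supConv_iff hε, Set.ofPred_exists]
  exact isOpen_iUnion fun y => isOpen_lt continuous_const (by fun_prop)

theorem LipschitzWith.measurable_supConv [MeasurableSpace E] [BorelSpace E]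
    (hu : LipschitzWith K u) (hε : 0 < ε) : Measurable (supConv ε u) :=
  measurable_of_Ioi fun t => (hu.isOpen_lt_supConv hε t).measurableSet

theorem LipschitzWith.supConv_eq_zero (hu : LipschitzWith K u) (hε : 0 < ε) (hε1 : ε ≤ 1)
    {L : ℝ} (hL : ∀ x, L < ‖x‖ → u x = 0) {x : E} (hx : L + 2 * K < ‖x‖) :
    supConv ε u x = 0 := by
  have hx0 : u x = 0 := hL x (by have := K.2; linarith)
  refine le_antisymm (ciSup_le fun y => ?_) (hx0 ▸ hu.le_supConv hε x)
  have hq : ‖y - x‖ ^ 2 / 2 ≤ ‖y - x‖ ^ 2 / (2 * ε) := by gcongr; linarith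
  rcases lt_or_ge L ‖y‖ with hy | hy
  · rw [hL y hy]
    have : 0 ≤ ‖y - x‖ ^ 2 := by positivity
    linarith
  · have h1 := hu.le_add_mul_norm_sub x y
    have h2 : 2 * K ≤ ‖y - x‖ := by
      have := norm_sub_norm_le x y
      rw [norm_sub_rev] at this
      linarith
    nlinarith [norm_nonneg (y - x)]

theorem LipschitzWith.tendsto_supConv_sub_div [InnerProductSpace ℝ E] [CompleteSpace E]
    (hu : LipschitzWith K u) {x : E}
    (hx : DifferentiableAt ℝ u x) :
    Tendsto (fun ε => (supConv ε u x - u x) / ε) (nhdsWithin 0 (Ioi 0))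
      (nhds (‖gradient u x‖ ^ 2 / 2)) := by
  set g := gradient u x with hg
  have hgrad : HasGradientAt u g x := hx.hasGradientAt
  rw [Metric.tendsto_nhds]
  intro e he
  set η := min 1 (e / (2 * (‖g‖ + 1))) with hη
  have hη0 : 0 < η := by positivity
  have hη1 : η ≤ 1 := min_le_left _ _
  have hηe : η * (2 * (‖g‖ + 1)) ≤ e := (le_div_iff₀ (by positivity)).1 (min_le_right _ _)
  have hlo := (hasGradientAt_iff_isLittleO.1 hgrad).def hη0
  obtain ⟨δ, hδ, hball⟩ := Metric.eventually_nhds_iff.1 hlo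
  have hev : ∀ᶠ ε in nhdsWithin (0 : ℝ) (Ioi 0), ε * (2 * K + ‖g‖) < δ := by
    have : Tendsto (fun ε : ℝ => ε * (2 * K + ‖g‖)) (nhdsWithin 0 (Ioi 0)) (nhds 0) := by
      refine tendsto_nhdsWithin_of_tendsto_nhds ?_
      have : Continuous fun ε : ℝ => ε * (2 * K + ‖g‖) := by fun_prop
      simpa using this.tendsto 0
    exact this.eventually_lt_const hδ
  filter_upwards [hev, self_mem_nhdsWithin] with ε hεδ (hε : 0 < ε)
  have hlow : ε * (‖g‖ ^ 2 / 2 - η * ‖g‖) ≤ supConv ε u x - u x := by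
    have h1 := hu.sub_le_supConv hε x (x + ε • g)
    have h2 := hball (y := x + ε • g) (by
      rw [dist_eq_norm]
      simp only [add_sub_cancel_left, norm_smul, Real.norm_eq_abs, abs_of_pos hε]
      nlinarith [K.2])
    simp only [add_sub_cancel_left, norm_smul, Real.norm_eq_abs, abs_of_pos hε, inner_smul_right,
      real_inner_self_eq_norm_sq] at h1 h2
    have h3 := (abs_le.1 h2).1
    have h4 : (ε * ‖g‖) ^ 2 / (2 * ε) = ε * ‖g‖ ^ 2 / 2 := by field_simp
    rw [h4] at h1
    linarith
  have hupp : supConv ε u x ≤ u x + ε * (‖g‖ + η) ^ 2 / 2 := by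
    refine ciSup_le fun y => ?_
    rcases le_or_gt ‖y - x‖ (2 * K * ε) with hr | hr
    · have h2 := (abs_le.1 (hball (y := y) (by rw [dist_eq_norm]; nlinarith [norm_nonneg g]))).2
      have h3 := real_inner_le_norm g (y - x)
      have h4 := mul_sub_sq_div_le hε (‖g‖ + η) ‖y - x‖
      linarith
    · have h1 := hu.le_add_mul_norm_sub x y
      have h2 : K * ‖y - x‖ ≤ ‖y - x‖ ^ 2 / (2 * ε) := by
        rw [le_div_iff₀ (by positivity)]
        nlinarith [norm_nonneg (y - x)]
      have : 0 ≤ ε * (‖g‖ + η) ^ 2 / 2 := by positivity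
      linarith
  rw [Real.dist_eq, abs_lt]
  constructor
  · rw [neg_lt_sub_iff_lt_add, ← sub_lt_iff_lt_add', lt_div_iff₀ hε]
    nlinarith [norm_nonneg g]
  · rw [sub_lt_iff_lt_add', div_lt_iff₀ hε]
    have : (‖g‖ + η) ^ 2 / 2 < ‖g‖ ^ 2 / 2 + e := by nlinarith [norm_nonneg g]
    nlinarith

theorem LipschitzWith.norm_gradient_le [InnerProductSpace ℝ E] [CompleteSpace E]
    (hu : LipschitzWith K u) (x : E) :
    ‖gradient u x‖ ≤ K := by
  rw [gradient, LinearIsometryEquiv.norm_map]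
  exact norm_fderiv_le_of_lipschitz ℝ hu

theorem LipschitzWith.tendsto_integral_supConv_sub_div [InnerProductSpace ℝ E]
    [FiniteDimensional ℝ E]
    [MeasurableSpace E] [BorelSpace E] {μ : Measure E} [μ.IsAddHaarMeasure]
    (hu : LipschitzWith K u) {L : ℝ} (hL : ∀ x, L < ‖x‖ → u x = 0) :
    Tendsto (fun n : ℕ => ∫ x, (supConv (1 / ((n : ℝ) + 1)) u x - u x) / (1 / ((n : ℝ) + 1)) ∂μ)
      atTop (nhds (∫ x, ‖gradient u x‖ ^ 2 / 2 ∂μ)) := by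
  have hpos : ∀ n : ℕ, (0 : ℝ) < 1 / ((n : ℝ) + 1) := fun n => by positivity
  have hle : ∀ n : ℕ, 1 / ((n : ℝ) + 1) ≤ 1 := fun n => by
    rw [div_le_one (by positivity)]; linarith [n.cast_nonneg (α := ℝ)]
  refine tendsto_integral_of_dominated_convergence
    ((closedBall (0 : E) (L + 2 * K)).indicator fun _ => (K : ℝ) ^ 2 / 2) (fun n => ?_) ?_
    (fun n => ae_of_all _ fun x => ?_) ?_
  · exact (((hu.measurable_supConv (hpos n)).sub hu.continuous.measurable).div_const
      _).aestronglyMeasurable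
  · exact (integrableOn_const measure_closedBall_lt_top.ne).integrable_indicator
      measurableSet_closedBall
  · by_cases hx : x ∈ closedBall (0 : E) (L + 2 * K)
    · rw [indicator_of_mem hx, Real.norm_eq_abs, abs_of_nonneg
        (div_nonneg (sub_nonneg.2 (hu.le_supConv (hpos n) x)) (hpos n).le), div_le_iff₀ (hpos n)]
      linarith [hu.supConv_le (hpos n) x]
    · rw [indicator_of_notMem hx]
      rw [mem_closedBall_zero_iff, not_le] at hx
      rw [hu.supConv_eq_zero (hpos n) (hle n) hL hx, hL x (by have := K.2; linarith)]
      simp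
  · filter_upwards [hu.ae_differentiableAt (μ := μ)] with x hx
    refine (hu.tendsto_supConv_sub_div hx).comp (tendsto_nhdsWithin_iff.2 ⟨?_, ?_⟩)
    · exact tendsto_one_div_add_atTop_nhds_zero_nat
    · exact Eventually.of_forall hpos

end SupConvolution

section Rearrangement

variable {d : ℕ}

theorem volume_ball_zero_eq (hd : 0 < d) (r : ℝ) :
    volume (ball (0 : EuclideanSpace ℝ (Fin d)) r) =
      ENNReal.ofReal r ^ d * volume (ball (0 : EuclideanSpace ℝ (Fin d)) 1) := by
  have : NeZero d := ⟨hd.ne'⟩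
  rcases le_or_gt 0 r with hr | hr
  · rw [Measure.addHaar_ball _ _ hr, ENNReal.ofReal_pow hr, finrank_euclideanSpace_fin]
  · rw [ball_eq_empty.2 hr.le, ENNReal.ofReal_of_nonpos hr.le]
    simp [hd.ne']

theorem volume_ball_zero_strictMono (hd : 0 < d) {r r' : ℝ} (h : r < r') (hr' : 0 < r') :
    volume (ball (0 : EuclideanSpace ℝ (Fin d)) r) <
      volume (ball (0 : EuclideanSpace ℝ (Fin d)) r') := by
  rw [volume_ball_zero_eq hd, volume_ball_zero_eq hd r']
  refine ENNReal.mul_lt_mul_left (measure_ball_pos _ _ one_pos).ne' measure_ball_lt_top.ne ?_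
  exact ENNReal.pow_lt_pow_left hd.ne' ((ENNReal.ofReal_lt_ofReal_iff hr').2 h)

theorem continuous_volume_ball_zero (hd : 0 < d) :
    Continuous fun r : ℝ => volume (ball (0 : EuclideanSpace ℝ (Fin d)) r) := by
  rw [funext (volume_ball_zero_eq hd)]
  exact (ENNReal.continuous_mul_const measure_ball_lt_top.ne).comp
    ((ENNReal.continuous_pow d).comp ENNReal.continuous_ofReal)

theorem exists_gt_volume_ball_zero_lt (hd : 0 < d) {ρ : ℝ} {m : ℝ≥0∞}
    (h : volume (ball (0 : EuclideanSpace ℝ (Fin d)) ρ) < m) :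
    ∃ ρ' > max ρ 0, volume (ball (0 : EuclideanSpace ℝ (Fin d)) ρ') < m := by
  have h0 : volume (ball (0 : EuclideanSpace ℝ (Fin d)) (max ρ 0)) < m := by
    rcases le_total 0 ρ with hρ | hρ
    · rwa [max_eq_left hρ]
    · rw [max_eq_right hρ]
      simpa using bot_le.trans_lt h
  have hev := (continuous_volume_ball_zero hd).continuousAt.eventually_lt_const h0
  obtain ⟨ρ', h1, h2⟩ := ((hev.filter_mono nhdsWithin_le_nhds).and
    (self_mem_nhdsWithin (a := max ρ 0) (s := Ioi (max ρ 0)))).exists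
  exact ⟨ρ', h2, h1⟩

theorem exists_volume_ball_zero_eq (hd : 0 < d) {m : ℝ≥0∞} (hm : m ≠ ∞) :
    ∃ R : ℝ, 0 ≤ R ∧ volume (ball (0 : EuclideanSpace ℝ (Fin d)) R) = m := by
  have hω0 : volume (ball (0 : EuclideanSpace ℝ (Fin d)) 1) ≠ 0 :=
    (measure_ball_pos _ _ one_pos).ne'
  have hωt : volume (ball (0 : EuclideanSpace ℝ (Fin d)) 1) ≠ ∞ := measure_ball_lt_top.ne
  refine ⟨(m / volume (ball (0 : EuclideanSpace ℝ (Fin d)) 1)).toReal ^ ((d : ℝ)⁻¹),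
    by positivity, ?_⟩
  rw [volume_ball_zero_eq hd, ← ENNReal.ofReal_pow (by positivity),
    Real.rpow_inv_natCast_pow (by positivity) hd.ne',
    ENNReal.ofReal_toReal (ENNReal.div_ne_top hm hω0), ENNReal.div_mul_cancel hω0 hωt]

theorem volume_setOf_volume_ball_norm_lt (hd : 0 < d) {m : ℝ≥0∞} (hm : m ≠ ∞) :
    volume {x : EuclideanSpace ℝ (Fin d) | volume (ball (0 : EuclideanSpace ℝ (Fin d)) ‖x‖) < m} =
      m := by
  obtain ⟨R, hR, rfl⟩ := exists_volume_ball_zero_eq hd hm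
  congr 1
  ext x
  simp only [mem_ofPred_eq, mem_ball_zero_iff]
  refine ⟨fun h => ?_, fun h => volume_ball_zero_strictMono hd h ((norm_nonneg x).trans_lt h)⟩
  by_contra hle
  exact h.not_ge (measure_mono (ball_subset_ball (not_lt.1 hle)))

theorem IsOpen.volume_ball_add_lt_volume_thickening (hd : 0 < d) {A : Set (EuclideanSpace ℝ (Fin d))}
    (hA : IsOpen A)
    {ρ τ : ℝ} (hτ : 0 < τ) (h : volume (ball (0 : EuclideanSpace ℝ (Fin d)) ρ) < volume A) :
    volume (ball (0 : EuclideanSpace ℝ (Fin d)) (ρ + τ)) < volume (thickening τ A) := by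
  obtain ⟨ρ', hρ', hlt⟩ := exists_gt_volume_ball_zero_lt hd h
  obtain ⟨h1, h2⟩ := max_lt_iff.1 hρ'
  exact (volume_ball_zero_strictMono hd (by linarith) (by linarith)).trans_le
    (hA.volume_ball_add_le_volume_thickening h2 hτ hlt.le)

/-- The profile of the symmetric decreasing rearrangement of `u`. -/
def rearr (u : EuclideanSpace ℝ (Fin d) → ℝ) (ρ : ℝ) : ℝ :=
  sInf {t | 0 ≤ t ∧ volume {x | t < u x} ≤ volume (ball (0 : EuclideanSpace ℝ (Fin d)) ρ)}

variable {u : EuclideanSpace ℝ (Fin d) → ℝ} {K : NNReal} {L : ℝ}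

theorem rearr_nonneg (u : EuclideanSpace ℝ (Fin d) → ℝ) (ρ : ℝ) : 0 ≤ rearr u ρ :=
  Real.sInf_nonneg fun _ h => h.1

theorem rearr_bddBelow (u : EuclideanSpace ℝ (Fin d) → ℝ) (ρ : ℝ) :
    BddBelow {t | 0 ≤ t ∧ volume {x | t < u x} ≤ volume (ball (0 : EuclideanSpace ℝ (Fin d)) ρ)} :=
  ⟨0, fun _ h => h.1⟩

theorem LipschitzWith.exists_bound (hu : LipschitzWith K u) (hL : ∀ x, L < ‖x‖ → u x = 0) :
    ∃ M : ℝ, 0 ≤ M ∧ ∀ x, |u x| ≤ M := by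
  obtain ⟨M, hM⟩ := (isCompact_closedBall (0 : EuclideanSpace ℝ (Fin d))
    L).exists_bound_of_continuousOn
    hu.continuous.continuousOn
  refine ⟨max M 0, le_max_right _ _, fun x => ?_⟩
  by_cases hx : L < ‖x‖
  · simp [hL x hx]
  · exact (hM x (by simpa using hx)).trans (le_max_left _ _)

theorem lt_rearr_iff (hu : LipschitzWith K u) (hL : ∀ x, L < ‖x‖ → u x = 0) {t : ℝ} (ht : 0 ≤ t)
    (ρ : ℝ) : t < rearr u ρ ↔
      volume (ball (0 : EuclideanSpace ℝ (Fin d)) ρ) < volume {x | t < u x} := by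
  refine ⟨fun h => ?_, fun h => ?_⟩
  · by_contra hle
    exact h.not_ge (csInf_le (rearr_bddBelow u ρ) ⟨ht, not_lt.1 hle⟩)
  · have hU : {x | t < u x} = ⋃ n : ℕ, {x | t + 1 / ((n : ℝ) + 1) < u x} := by
      ext x
      simp only [mem_ofPred_eq, mem_iUnion]
      refine ⟨fun hx => ?_, fun ⟨n, hn⟩ => ?_⟩
      · obtain ⟨n, hn⟩ := exists_nat_one_div_lt (sub_pos.2 hx)
        exact ⟨n, by linarith⟩
      · have : (0 : ℝ) < 1 / ((n : ℝ) + 1) := by positivity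
        linarith
    have hmono : Monotone fun n : ℕ => {x | t + 1 / ((n : ℝ) + 1) < u x} := by
      intro a b hab x hx
      simp only [mem_ofPred_eq] at hx ⊢
      have := Nat.one_div_le_one_div (α := ℝ) hab
      linarith
    rw [hU, hmono.measure_iUnion] at h
    obtain ⟨n, hn⟩ := lt_iSup_iff.1 h
    obtain ⟨M, hM0, hM⟩ := hu.exists_bound hL
    have hne :
      {t | 0 ≤ t ∧ volume {x | t < u x} ≤ volume (ball (0 : EuclideanSpace ℝ (Fin d)) ρ)}.Nonempty := by
      refine ⟨M, hM0, ?_⟩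
      have : {x | M < u x} = ∅ := by
        ext x; simpa using (le_abs_self _).trans (hM x)
      simp [this]
    have h1 : t + 1 / ((n : ℝ) + 1) ≤ rearr u ρ := by
      refine le_csInf hne fun t' ht' => ?_
      by_contra hlt
      refine (hn.trans_le ((measure_mono fun x (hx : _ < u x) => ?_).trans ht'.2)).false
      exact (not_le.1 hlt).trans hx
    have : (0 : ℝ) < 1 / ((n : ℝ) + 1) := by positivity
    linarith

theorem rearr_antitone (hu : LipschitzWith K u) (hL : ∀ x, L < ‖x‖ → u x = 0) :
    Antitone (rearr u) := by
  intro a b hab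
  by_contra hlt
  rw [not_le, lt_rearr_iff hu hL (rearr_nonneg u a)] at hlt
  have := (measure_mono (ball_subset_ball hab)).trans_lt hlt
  rw [← lt_rearr_iff hu hL (rearr_nonneg u a)] at this
  exact this.false

theorem rearr_eq_zero (hu : LipschitzWith K u) (hL : ∀ x, L < ‖x‖ → u x = 0) {ρ : ℝ}
    (h : volume {x | 0 < u x} ≤ volume (ball (0 : EuclideanSpace ℝ (Fin d)) ρ)) :
      rearr u ρ = 0 := by
  refine le_antisymm (not_lt.1 fun hlt => ?_) (rearr_nonneg u ρ)
  rw [lt_rearr_iff hu hL le_rfl] at hlt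
  exact hlt.not_ge h

theorem LipschitzWith.thickening_subset (hu : LipschitzWith K u) {δ t : ℝ} :
    thickening δ {x | t + K * δ < u x} ⊆ {x | t < u x} := by
  intro x hx
  obtain ⟨z, hz, hxz⟩ := mem_thickening_iff.1 hx
  have := hu.le_add_mul_norm_sub x z
  rw [dist_comm, dist_eq_norm] at hxz
  have h2 : K * ‖z - x‖ ≤ K * δ := mul_le_mul_of_nonneg_left hxz.le K.2
  simp only [mem_ofPred_eq] at hz ⊢
  linarith

theorem LipschitzWith.rearr (hd : 0 < d) (hu : LipschitzWith K u)
    (hL : ∀ x, L < ‖x‖ → u x = 0) : LipschitzWith K (rearr u) := by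
  refine LipschitzWith.of_le_add_mul K fun a b => ?_
  rcases le_or_gt b a with hab | hab
  · have := rearr_antitone hu hL hab
    have := mul_nonneg K.2 (dist_nonneg (x := a) (y := b))
    simp only [NNReal.val_eq_coe] at this
    linarith
  · have hδ : 0 < b - a := sub_pos.2 hab
    rw [Real.dist_eq, abs_sub_comm, abs_of_pos hδ]
    by_contra hlt
    have h0 := rearr_nonneg u b
    have hK := K.2
    simp only [NNReal.val_eq_coe] at hK
    rw [not_le, lt_rearr_iff hu hL (by positivity)] at hlt
    have := ((isOpen_lt continuous_const hu.continuous).volume_ball_add_lt_volume_thickening hd hδ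
      hlt).trans_le (measure_mono hu.thickening_subset)
    rw [add_sub_cancel, ← lt_rearr_iff hu hL h0] at this
    exact this.false

theorem volume_lt_ne_top (hL : ∀ x, L < ‖x‖ → u x = 0) {t : ℝ} (ht : 0 ≤ t) :
    volume {x | t < u x} ≠ ∞ := by
  refine ne_top_of_le_ne_top (measure_closedBall_lt_top (x := (0 : EuclideanSpace ℝ (Fin d)))
    (r := L)).ne
    (measure_mono fun x hx => ?_)
  by_contra hxL
  rw [mem_closedBall_zero_iff, not_le] at hxL
  rw [mem_ofPred_eq, hL x hxL] at hx
  linarith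

theorem volume_lt_rearr_norm (hd : 0 < d) (hu : LipschitzWith K u)
    (hL : ∀ x, L < ‖x‖ → u x = 0) {t : ℝ} (ht : 0 ≤ t) :
    volume {x : EuclideanSpace ℝ (Fin d) | t < rearr u ‖x‖} = volume {x | t < u x} := by
  simp only [lt_rearr_iff hu hL ht]
  exact volume_setOf_volume_ball_norm_lt hd (volume_lt_ne_top hL ht)

theorem LipschitzWith.rearr_norm (hd : 0 < d) (hu : LipschitzWith K u)
    (hL : ∀ x, L < ‖x‖ → u x = 0) : LipschitzWith K fun x : EuclideanSpace ℝ (Fin d) =>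
      _root_.rearr u ‖x‖ := by
  have := (hu.rearr hd hL).comp (lipschitzWith_one_norm (E := (EuclideanSpace ℝ (Fin d))))
  rw [mul_one] at this
  exact this

theorem rearr_eq_zero_of_lt (hu : LipschitzWith K u) (hL : ∀ x, L < ‖x‖ → u x = 0)
    {ρ : ℝ} (h : L < ρ) : rearr u ρ = 0 := by
  refine rearr_eq_zero hu hL (measure_mono fun x hx => ?_)
  by_contra hxL
  rw [mem_ball_zero_iff, not_lt] at hxL
  rw [mem_ofPred_eq, hL x (h.trans_le hxL)] at hx
  exact hx.false

theorem integral_rearr_norm_rpow (hd : 0 < d) (hu : LipschitzWith K u)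
    (hL : ∀ x, L < ‖x‖ → u x = 0) (hu0 : ∀ x, 0 ≤ u x) {p : ℝ} (hp : 0 < p) :
    ∫ x : EuclideanSpace ℝ (Fin d), rearr u ‖x‖ ^ p = ∫ x, u x ^ p := by
  have hU := hu.rearr_norm hd hL
  rw [integral_eq_lintegral_of_nonneg_ae (ae_of_all _ fun x => Real.rpow_nonneg (hu0 x) _)
      (hu.continuous.measurable.pow_const p).aestronglyMeasurable,
    integral_eq_lintegral_of_nonneg_ae
      (ae_of_all _ fun x => Real.rpow_nonneg (rearr_nonneg _ _) _)
      (hU.continuous.measurable.pow_const p).aestronglyMeasurable,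
    lintegral_rpow_eq_lintegral_meas_lt_mul _ (ae_of_all _ hu0) hu.continuous.aemeasurable hp,
    lintegral_rpow_eq_lintegral_meas_lt_mul _ (ae_of_all _ fun x => rearr_nonneg _ _)
      hU.continuous.aemeasurable hp]
  congr 2
  refine setLIntegral_congr_fun measurableSet_Ioi fun t ht => ?_
  simp only [volume_lt_rearr_norm hd hu hL (le_of_lt ht)]

theorem volume_lt_supConv_rearr_le (hd : 0 < d) (hu : LipschitzWith K u)
    (hL : ∀ x, L < ‖x‖ → u x = 0) {ε t : ℝ} (hε : 0 < ε) (ht : 0 ≤ t) :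
    volume {x : EuclideanSpace ℝ (Fin d) | t < supConv ε
      (fun x : EuclideanSpace ℝ (Fin d) => rearr u ‖x‖) x} ≤
      volume {x | t < supConv ε u x} := by
  rcases eq_or_ne (volume {x | t < supConv ε u x}) ∞ with hm | hm
  · simp [hm]
  conv_rhs => rw [← volume_setOf_volume_ball_norm_lt hd hm]
  refine measure_mono fun x hx => ?_
  obtain ⟨y, hy⟩ := ((hu.rearr_norm hd hL).lt_supConv_iff hε x t).1 hx
  have hq : 0 ≤ ‖y - x‖ ^ 2 / (2 * ε) := by positivity
  rw [lt_sub_iff_add_lt, lt_rearr_iff hu hL (by positivity)] at hy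
  rw [mem_ofPred_eq]
  rcases eq_or_ne y x with rfl | hne
  · refine hy.trans_le (measure_mono fun z hz => ?_)
    have : t < u z := by simpa using hz
    exact this.trans_le (hu.le_supConv hε z)
  · have hτ : 0 < ‖y - x‖ := norm_pos_iff.2 (sub_ne_zero.2 hne)
    have hx' : ‖x‖ ≤ ‖y‖ + ‖y - x‖ := by
      have := norm_sub_norm_le x y
      rw [norm_sub_rev] at this
      linarith
    refine (measure_mono (ball_subset_ball hx')).trans_lt
      (((isOpen_lt continuous_const hu.continuous).volume_ball_add_lt_volume_thickening hd hτ
        hy).trans_le (measure_mono fun z hz => ?_))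
    obtain ⟨w, hw, hzw⟩ := mem_thickening_iff.1 hz
    refine lt_of_lt_of_le ?_ (hu.sub_le_supConv hε z w)
    rw [dist_comm, dist_eq_norm] at hzw
    have : ‖w - z‖ ^ 2 / (2 * ε) ≤ ‖y - x‖ ^ 2 / (2 * ε) := by gcongr
    simp only [mem_ofPred_eq] at hw
    linarith

theorem LipschitzWith.integrable_of_eq_zero (hu : LipschitzWith K u)
    (hL : ∀ x, L < ‖x‖ → u x = 0) : Integrable u := by
  refine hu.continuous.integrable_of_hasCompactSupport
    (HasCompactSupport.intro (isCompact_closedBall (0 : EuclideanSpace ℝ (Fin d)) L)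
      fun x hx => hL x ?_)
  simpa using hx

theorem LipschitzWith.integrable_supConv (hu : LipschitzWith K u)
    (hL : ∀ x, L < ‖x‖ → u x = 0) {ε : ℝ} (hε : 0 < ε) (hε1 : ε ≤ 1) :
    Integrable (supConv ε u) := by
  have h1 := hu.integrable_of_eq_zero hL
  have h2 : Integrable ((closedBall (0 : EuclideanSpace ℝ (Fin d)) (L + 2 * K)).indicator
      fun _ => ε * (K : ℝ) ^ 2 / 2) :=
    (integrableOn_const measure_closedBall_lt_top.ne).integrable_indicator
      measurableSet_closedBall
  have h3 : Integrable (fun x => supConv ε u x - u x) := by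
    refine h2.mono' ((hu.measurable_supConv hε).sub
      hu.continuous.measurable).aestronglyMeasurable (ae_of_all _ fun x => ?_)
    rw [Real.norm_eq_abs, abs_of_nonneg (sub_nonneg.2 (hu.le_supConv hε x))]
    by_cases hx : x ∈ closedBall (0 : EuclideanSpace ℝ (Fin d)) (L + 2 * K)
    · rw [indicator_of_mem hx]
      linarith [hu.supConv_le hε x]
    · rw [indicator_of_notMem hx]
      rw [mem_closedBall_zero_iff, not_le] at hx
      rw [hu.supConv_eq_zero hε hε1 hL hx, hL x (by have := K.2; linarith)]
      simp
  exact (h3.add h1).congr (ae_of_all _ fun x => sub_add_cancel _ _)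

theorem integral_supConv_rearr_le (hd : 0 < d) (hu : LipschitzWith K u)
    (hL : ∀ x, L < ‖x‖ → u x = 0) (hu0 : ∀ x, 0 ≤ u x) {ε : ℝ} (hε : 0 < ε) (hε1 : ε ≤ 1) :
    ∫ x, supConv ε (fun x : EuclideanSpace ℝ (Fin d) => rearr u ‖x‖) x ≤ ∫ x, supConv ε u x := by
  have hU := hu.rearr_norm hd hL
  have h0 : ∀ x, 0 ≤ supConv ε u x := fun x => (hu0 x).trans (hu.le_supConv hε x)
  have h0' : ∀ x, 0 ≤ supConv ε (fun x : EuclideanSpace ℝ (Fin d) => rearr u ‖x‖) x := fun x =>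
    (rearr_nonneg _ _).trans (hU.le_supConv hε x)
  have hint := hu.integrable_supConv hL hε hε1
  rw [integral_eq_lintegral_of_nonneg_ae (ae_of_all _ h0) hint.1,
    integral_eq_lintegral_of_nonneg_ae (ae_of_all _ h0')
      (hU.measurable_supConv hε).aestronglyMeasurable]
  refine ENNReal.toReal_mono ?_ ?_
  · exact ((hasFiniteIntegral_iff_ofReal (ae_of_all _ h0)).1 hint.2).ne
  rw [lintegral_eq_lintegral_meas_lt _ (ae_of_all _ h0) (hu.measurable_supConv hε).aemeasurable,
    lintegral_eq_lintegral_meas_lt _ (ae_of_all _ h0') (hU.measurable_supConv hε).aemeasurable]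
  exact setLIntegral_mono' measurableSet_Ioi fun t ht =>
    volume_lt_supConv_rearr_le hd hu hL hε (le_of_lt ht)

/-- The Pólya-Szegő inequality for Lipschitz functions of bounded support. -/
theorem integral_norm_gradient_rearr_le (hd : 0 < d) (hu : LipschitzWith K u)
    (hL : ∀ x, L < ‖x‖ → u x = 0) (hu0 : ∀ x, 0 ≤ u x) :
    ∫ x : EuclideanSpace ℝ (Fin d), ‖gradient (fun x : EuclideanSpace ℝ (Fin d) => rearr u ‖x‖) x‖ ^ 2 ≤
      ∫ x, ‖gradient u x‖ ^ 2 := by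
  have hU := hu.rearr_norm hd hL
  have hUL : ∀ x : EuclideanSpace ℝ (Fin d), L < ‖x‖ → rearr u ‖x‖ = 0 :=
    fun x hx => rearr_eq_zero_of_lt hu hL hx
  have hone : ∫ x : EuclideanSpace ℝ (Fin d), rearr u ‖x‖ = ∫ x, u x := by
    simpa using integral_rearr_norm_rpow hd hu hL hu0 one_pos
  have h := le_of_tendsto_of_tendsto' (hU.tendsto_integral_supConv_sub_div (μ := volume) hUL)
    (hu.tendsto_integral_supConv_sub_div (μ := volume) hL) fun n => by
      have hpos : (0 : ℝ) < 1 / ((n : ℝ) + 1) := by positivity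
      have hle : 1 / ((n : ℝ) + 1) ≤ 1 := by
        rw [div_le_one (by positivity)]; linarith [n.cast_nonneg (α := ℝ)]
      rw [integral_div, integral_div]
      refine div_le_div_of_nonneg_right ?_ hpos.le
      rw [integral_sub (hU.integrable_supConv hUL hpos hle) (hU.integrable_of_eq_zero hUL),
        integral_sub (hu.integrable_supConv hL hpos hle) (hu.integrable_of_eq_zero hL), hone]
      linarith [integral_supConv_rearr_le hd hu hL hu0 hpos hle]
  rw [integral_div, integral_div] at h
  linarith

end Rearrangement

section OneDimensional

variable {d : ℕ} {R : ℝ}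

/-- The involution of `[0, 2 ^ (1 / d) * R]` with `ρ ^ d + reflect d R ρ ^ d = 2 * R ^ d`. -/
def reflect (d : ℕ) (R ρ : ℝ) : ℝ := (2 * R ^ d - ρ ^ d) ^ ((d : ℝ)⁻¹)

theorem reflect_pow (hd : 0 < d) {ρ : ℝ} (h : ρ ^ d ≤ 2 * R ^ d) :
    reflect d R ρ ^ d = 2 * R ^ d - ρ ^ d :=
  Real.rpow_inv_natCast_pow (by linarith) hd.ne'

theorem reflect_nonneg {ρ : ℝ} (h : ρ ^ d ≤ 2 * R ^ d) : 0 ≤ reflect d R ρ :=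
  Real.rpow_nonneg (by linarith) _

theorem pow_le_two_mul_pow (hR : 0 < R) {ρ : ℝ} (h0 : 0 ≤ ρ) (h : ρ ≤ R) :
    ρ ^ d ≤ 2 * R ^ d := by
  have := pow_le_pow_left₀ h0 h d
  have := pow_pos hR d
  linarith

theorem le_reflect (hd : 0 < d) (hR : 0 < R) {ρ t : ℝ} (h0 : 0 ≤ ρ) (h : ρ ≤ R)
    (ht : t ^ d + ρ ^ d ≤ 2 * R ^ d) : t ≤ reflect d R ρ := by
  have hρ := pow_le_two_mul_pow (d := d) hR h0 h
  refine le_of_pow_le_pow_left₀ hd.ne' (reflect_nonneg hρ) ?_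
  rw [reflect_pow hd hρ]
  linarith

theorem le_reflect_self (hd : 0 < d) (hR : 0 < R) {ρ : ℝ} (h0 : 0 ≤ ρ) (h : ρ ≤ R) :
    R ≤ reflect d R ρ :=
  le_reflect hd hR h0 h (by linarith [pow_le_pow_left₀ h0 h d])

theorem reflect_lt_reflect (hd : 0 < d) (hR : 0 < R) {ρ σ : ℝ} (h0 : 0 ≤ ρ) (h : ρ < σ)
    (hσ : σ ≤ R) : reflect d R σ < reflect d R ρ := by
  have h1 := pow_le_two_mul_pow (d := d) hR h0 (h.le.trans hσ)
  have h2 := pow_le_two_mul_pow (d := d) hR (h0.trans h.le) hσ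
  refine lt_of_pow_lt_pow_left₀ d (reflect_nonneg h1) ?_
  rw [reflect_pow hd h1, reflect_pow hd h2]
  linarith [pow_lt_pow_left₀ h h0 hd.ne']

theorem reflect_self (hd : 0 < d) (hR : 0 < R) : reflect d R R = R := by
  rw [reflect, two_mul, add_sub_cancel_right, Real.pow_rpow_inv_natCast hR.le hd.ne']

theorem reflect_reflect (hd : 0 < d) {ρ : ℝ} (h0 : 0 ≤ ρ) (h : ρ ^ d ≤ 2 * R ^ d) :
    reflect d R (reflect d R ρ) = ρ := by
  rw [reflect, reflect_pow hd h, sub_sub_cancel, Real.pow_rpow_inv_natCast h0 hd.ne']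

theorem hasDerivAt_reflect (hd : 0 < d) {ρ : ℝ} (h : ρ ^ d < 2 * R ^ d) :
    HasDerivAt (reflect d R) (-(ρ ^ (d - 1) / reflect d R ρ ^ (d - 1))) ρ := by
  have h1 : HasDerivAt (fun ρ : ℝ => 2 * R ^ d - ρ ^ d) (-(d * ρ ^ (d - 1))) ρ :=
    (hasDerivAt_pow d ρ).const_sub _
  have hpos : 0 < 2 * R ^ d - ρ ^ d := by linarith
  refine (h1.rpow_const (p := (d : ℝ)⁻¹) (Or.inl hpos.ne')).congr_deriv ?_
  have hd' : (d : ℝ) ≠ 0 := by exact_mod_cast hd.ne'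
  have h2 : (2 * R ^ d - ρ ^ d) ^ ((d : ℝ)⁻¹ - 1) = (reflect d R ρ ^ (d - 1))⁻¹ := by
    rw [reflect, ← Real.rpow_natCast _ (d - 1), ← Real.rpow_mul hpos.le, ← Real.rpow_neg hpos.le,
      Nat.cast_sub hd, Nat.cast_one]
    congr 1
    field_simp
    ring
  rw [h2]
  field_simp

theorem lipschitzOnWith_reflect (hd : 0 < d) (hR : 0 < R) :
    LipschitzOnWith 1 (reflect d R) (Icc 0 R) := by
  refine (convex_Icc 0 R).lipschitzOnWith_of_nnnorm_hasDerivWithin_le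
    (f' := fun ρ => -(ρ ^ (d - 1) / reflect d R ρ ^ (d - 1))) (fun ρ hρ =>
      (hasDerivAt_reflect hd ?_).hasDerivWithinAt) fun ρ hρ => ?_
  · linarith [pow_le_pow_left₀ hρ.1 hρ.2 d, pow_pos hR d]
  · have h := le_reflect_self hd hR hρ.1 hρ.2
    rw [← NNReal.coe_le_coe, coe_nnnorm, norm_neg, Real.norm_eq_abs, NNReal.coe_one,
      abs_of_nonneg (div_nonneg (pow_nonneg hρ.1 _) (pow_nonneg (hR.le.trans h) _))]
    exact div_le_one_of_le₀ (pow_le_pow_left₀ hρ.1 (hρ.2.trans h) _)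
      (pow_nonneg (hR.le.trans h) _)

theorem image_reflect (hd : 0 < d) (hR : 0 < R) :
    reflect d R '' Ioo 0 R = Ioo R (reflect d R 0) := by
  ext ρ
  constructor
  · rintro ⟨σ, hσ, rfl⟩
    refine ⟨?_, reflect_lt_reflect hd hR le_rfl hσ.1 hσ.2.le⟩
    have := reflect_lt_reflect hd hR hσ.1.le hσ.2 le_rfl
    rwa [reflect_self hd hR] at this
  · rintro ⟨h1, h2⟩
    have hρ0 : 0 ≤ ρ := hR.le.trans h1.le
    have h0 := reflect_pow (R := R) hd (pow_le_two_mul_pow (d := d) hR le_rfl hR.le)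
    have h3 : ρ ^ d < 2 * R ^ d := by
      have := pow_lt_pow_left₀ h2 hρ0 hd.ne'
      rwa [h0, zero_pow hd.ne', sub_zero] at this
    refine ⟨reflect d R ρ, ⟨?_, ?_⟩, reflect_reflect hd hρ0 h3.le⟩
    · exact Real.rpow_pos_of_pos (by linarith) _
    · refine lt_of_pow_lt_pow_left₀ d hR.le ?_
      rw [reflect_pow hd h3.le]
      linarith [pow_lt_pow_left₀ h1 hR.le hd.ne']

theorem injOn_reflect (hd : 0 < d) (hR : 0 < R) : InjOn (reflect d R) (Ioo 0 R) :=
  fun ρ hρ σ hσ h => by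
    rw [← reflect_reflect hd hρ.1.le (pow_le_two_mul_pow hR hρ.1.le hρ.2.le), h,
      reflect_reflect hd hσ.1.le (pow_le_two_mul_pow hR hσ.1.le hσ.2.le)]

theorem abs_deriv_reflect_mul (hd : 0 < d) (hR : 0 < R) (H : ℝ → ℝ) {ρ : ℝ} (hρ : ρ ∈ Ioo 0 R) :
    |(-(ρ ^ (d - 1) / reflect d R ρ ^ (d - 1)))| • (reflect d R ρ ^ (d - 1) * H (reflect d R ρ)) =
      ρ ^ (d - 1) * H (reflect d R ρ) := by
  have h := hR.trans_le (le_reflect_self hd hR hρ.1.le hρ.2.le)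
  have := hρ.1
  rw [abs_neg, abs_of_nonneg (by positivity), smul_eq_mul]
  field_simp

theorem hasDerivWithinAt_reflect (hd : 0 < d) (hR : 0 < R) (ρ : ℝ) (hρ : ρ ∈ Ioo 0 R) :
    HasDerivWithinAt (reflect d R) (-(ρ ^ (d - 1) / reflect d R ρ ^ (d - 1))) (Ioo 0 R) ρ :=
  (hasDerivAt_reflect hd
    (by linarith [pow_le_pow_left₀ hρ.1.le hρ.2.le d, pow_pos hR d])).hasDerivWithinAt

theorem integral_reflect (hd : 0 < d) (hR : 0 < R) (H : ℝ → ℝ) :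
    ∫ ρ in Ioo R (reflect d R 0), ρ ^ (d - 1) * H ρ =
      ∫ ρ in Ioo 0 R, ρ ^ (d - 1) * H (reflect d R ρ) := by
  rw [← image_reflect hd hR, integral_image_eq_integral_abs_deriv_smul measurableSet_Ioo
    (hasDerivWithinAt_reflect hd hR) (injOn_reflect hd hR)]
  exact setIntegral_congr_fun measurableSet_Ioo fun ρ hρ => abs_deriv_reflect_mul hd hR H hρ

theorem integrableOn_reflect (hd : 0 < d) (hR : 0 < R) {H : ℝ → ℝ}
    (h : IntegrableOn (fun ρ => ρ ^ (d - 1) * H ρ) (Ioo R (reflect d R 0))) :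
    IntegrableOn (fun ρ => ρ ^ (d - 1) * H (reflect d R ρ)) (Ioo 0 R) := by
  rw [← image_reflect hd hR, integrableOn_image_iff_integrableOn_abs_deriv_smul measurableSet_Ioo
    (hasDerivWithinAt_reflect hd hR) (injOn_reflect hd hR)] at h
  exact h.congr_fun (fun ρ hρ => abs_deriv_reflect_mul hd hR H hρ) measurableSet_Ioo

theorem setIntegral_Ioi_eq_add (hd : 0 < d) (hR : 0 < R) {g : ℝ → ℝ}
    (hg : ∀ ρ, reflect d R 0 < ρ → g ρ = 0)
    (h1 : IntegrableOn (fun ρ => ρ ^ (d - 1) * g ρ) (Ioo 0 R))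
    (h2 : IntegrableOn (fun ρ => ρ ^ (d - 1) * g ρ) (Ioo R (reflect d R 0))) :
    ∫ ρ in Ioi 0, ρ ^ (d - 1) * g ρ = (∫ ρ in Ioo 0 R, ρ ^ (d - 1) * g ρ) +
      ∫ ρ in Ioo 0 R, ρ ^ (d - 1) * g (reflect d R ρ) := by
  have hS : R < reflect d R 0 := by
    have := reflect_lt_reflect hd hR le_rfl hR le_rfl
    rwa [reflect_self hd hR] at this
  rw [← integral_reflect hd hR g, ← setIntegral_union _ measurableSet_Ioo h1 h2]
  · refine setIntegral_eq_of_subset_of_ae_sdiff_eq_zero measurableSet_Ioi.nullMeasurableSet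
      (union_subset (fun ρ h => h.1) fun ρ h => hR.trans h.1) ?_
    have hR0 : ∀ᵐ ρ : ℝ, ρ ≠ R := by simp [ae_iff]
    have hS0 : ∀ᵐ ρ : ℝ, ρ ≠ reflect d R 0 := by simp [ae_iff]
    filter_upwards [hR0, hS0] with ρ h3 h4 h5
    rw [hg, mul_zero]
    by_contra! h6
    refine h5.2 ?_
    rcases lt_or_gt_of_ne h3 with h | h
    · exact Or.inl ⟨h5.1, h⟩
    · exact Or.inr ⟨h, lt_of_le_of_ne h6 h4⟩
  · exact Set.disjoint_left.2 fun ρ h h' => lt_asymm h.2 h'.1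

theorem integrableOn_pow_mul {H : ℝ → ℝ} (hH : Measurable H) {C : ℝ} (hC : ∀ ρ, |H ρ| ≤ C)
    (x y : ℝ) :
    IntegrableOn (fun ρ => ρ ^ (d - 1) * H ρ) (Ioo x y) := by
  have h : IntegrableOn (fun ρ : ℝ => ρ ^ (d - 1)) (Ioo x y) :=
    ((continuous_pow _).continuousOn.integrableOn_Icc).mono_set Ioo_subset_Icc_self
  exact h.mul_bdd hH.aestronglyMeasurable (ae_of_all _ hC)

theorem setIntegral_Ioi_eq_Ioo {g : ℝ → ℝ} (hg : ∀ ρ, R < ρ → g ρ = 0) :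
    ∫ ρ in Ioi 0, ρ ^ (d - 1) * g ρ = ∫ ρ in Ioo 0 R, ρ ^ (d - 1) * g ρ := by
  refine setIntegral_eq_of_subset_of_ae_sdiff_eq_zero measurableSet_Ioi.nullMeasurableSet
    (fun ρ h => h.1) ?_
  have hR0 : ∀ᵐ ρ : ℝ, ρ ≠ R := by simp [ae_iff]
  filter_upwards [hR0] with ρ h3 h5
  rw [hg, mul_zero]
  by_contra! h6
  exact h5.2 ⟨h5.1, lt_of_le_of_ne h6 h3⟩

theorem deriv_eq_zero_of_forall_le {F : ℝ → ℝ} {a : ℝ} (hF : ∀ ρ, a ≤ ρ → F ρ = 0) {ρ : ℝ}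
    (hρ : a < ρ) : deriv F ρ = 0 := by
  have : F =ᶠ[nhds ρ] fun _ => 0 := by
    filter_upwards [Ioi_mem_nhds hρ] with x hx using hF x (le_of_lt hx)
  rw [this.deriv_eq, deriv_const]

/-- `F - F R`, cut off at `R`. -/
def innerPart (R : ℝ) (F : ℝ → ℝ) (ρ : ℝ) : ℝ := F (min ρ R) - F R

/-- `F R - F ∘ reflect d R + G`, cut off at `R`. -/
def outerPart (d : ℕ) (R : ℝ) (F G : ℝ → ℝ) (ρ : ℝ) : ℝ :=
  F R - F (reflect d R (max 0 (min ρ R))) + G (max 0 (min ρ R))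

variable {F G : ℝ → ℝ} {K K' : NNReal} {a b : ℝ}

theorem innerPart_eq_zero {ρ : ℝ} (h : R ≤ ρ) : innerPart R F ρ = 0 := by
  rw [innerPart, min_eq_right h, sub_self]

theorem outerPart_eq_zero (hd : 0 < d) (hR : 0 < R) (hbR : b ≤ R) (hG : ∀ ρ, b ≤ ρ → G ρ = 0)
    {ρ : ℝ} (h : R ≤ ρ) : outerPart d R F G ρ = 0 := by
  rw [outerPart, min_eq_right h, max_eq_right hR.le, reflect_self hd hR, hG R hbR]
  ring

theorem lipschitzWith_innerPart (hF : LipschitzWith K F) : LipschitzWith K (innerPart R F) := by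
  have h := (hF.comp (LipschitzWith.id.min_const R)).sub (LipschitzWith.const (F R))
  rw [mul_one, add_zero] at h
  exact h

theorem lipschitzWith_outerPart (hd : 0 < d) (hR : 0 < R) (hF : LipschitzWith K F)
    (hG : LipschitzWith K' G) : ∃ L, LipschitzWith L (outerPart d R F G) := by
  have hm : LipschitzWith 1 fun ρ : ℝ => max 0 (min ρ R) :=
    (LipschitzWith.id.min_const R).const_max 0
  have hr : LipschitzWith 1 fun ρ : ℝ => reflect d R (max 0 (min ρ R)) := by
    rw [← lipschitzOnWith_univ]
    have := (lipschitzOnWith_reflect hd hR).comp (lipschitzOnWith_univ.2 hm)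
      fun ρ _ => ⟨le_max_left _ _, max_le hR.le (min_le_right _ _)⟩
    rw [mul_one] at this
    exact this
  exact ⟨_, ((LipschitzWith.const (F R)).sub (hF.comp hr)).add (hG.comp hm)⟩

theorem innerPart_eventuallyEq {ρ : ℝ} (hρ : ρ < R) :
    innerPart R F =ᶠ[nhds ρ] fun ρ => F ρ - F R := by
  filter_upwards [Iio_mem_nhds hρ] with σ hσ
  rw [innerPart, min_eq_left (le_of_lt hσ)]

theorem outerPart_eq {ρ : ℝ} (hρ : ρ ∈ Ioo 0 R) :
    outerPart d R F G ρ = F R - F (reflect d R ρ) + G ρ := by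
  rw [outerPart, min_eq_left hρ.2.le, max_eq_right hρ.1.le]

theorem apply_reflect_eq_zero (hd : 0 < d) (hR : 0 < R) (hF : ∀ ρ, a ≤ ρ → F ρ = 0)
    (hab : a ^ d + b ^ d ≤ 2 * R ^ d) {ρ : ℝ} (hρ : 0 ≤ ρ) (hρR : ρ ≤ R) (hρb : ρ ≤ b) :
    F (reflect d R ρ) = 0 :=
  hF _ (le_reflect hd hR hρ hρR (by linarith [pow_le_pow_left₀ hρ hρb d]))

theorem deriv_outerPart_of_lt (hd : 0 < d) (hR : 0 < R) (hF : ∀ ρ, a ≤ ρ → F ρ = 0)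
    (hab : a ^ d + b ^ d ≤ 2 * R ^ d) {ρ : ℝ} (hρ : ρ ∈ Ioo 0 R) (hρb : ρ < b) :
    deriv (outerPart d R F G) ρ = deriv G ρ := by
  have : outerPart d R F G =ᶠ[nhds ρ] fun ρ => F R + G ρ := by
    filter_upwards [Ioo_mem_nhds hρ.1 hρ.2, Iio_mem_nhds hρb] with σ hσ hσb
    rw [outerPart_eq hσ, apply_reflect_eq_zero hd hR hF hab hσ.1.le hσ.2.le (le_of_lt hσb),
      sub_zero]
  rw [this.deriv_eq, deriv_const_add]

theorem abs_deriv_outerPart_le_of_gt (hd : 0 < d) (hR : 0 < R) (hG : ∀ ρ, b ≤ ρ → G ρ = 0)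
    {ρ : ℝ} (hρ : ρ ∈ Ioo 0 R) (hρb : b < ρ) :
    |deriv (outerPart d R F G) ρ| ≤ |deriv F (reflect d R ρ)| := by
  have heq : ∀ σ ∈ Ioo 0 R, b < σ → outerPart d R F G σ = F R - F (reflect d R σ) := by
    intro σ hσ hσb
    rw [outerPart_eq hσ, hG σ hσb.le, add_zero]
  have hev : outerPart d R F G =ᶠ[nhds ρ] fun ρ => F R - F (reflect d R ρ) := by
    filter_upwards [Ioo_mem_nhds hρ.1 hρ.2, Ioi_mem_nhds hρb] with σ hσ hσb using heq σ hσ hσb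
  have hpow : ρ ^ d < 2 * R ^ d := by
    linarith [pow_le_pow_left₀ hρ.1.le hρ.2.le d, pow_pos hR d]
  have hψ := hasDerivAt_reflect hd hpow
  have hRψ := le_reflect_self hd hR hρ.1.le hρ.2.le
  by_cases hdiff : DifferentiableAt ℝ F (reflect d R ρ)
  · have h : HasDerivAt (fun σ => F R - F (reflect d R σ)) _ ρ :=
      (hdiff.hasDerivAt.comp ρ hψ).const_sub (F R)
    rw [hev.deriv_eq, h.deriv, abs_neg, abs_mul]
    refine mul_le_of_le_one_right (abs_nonneg _) ?_
    rw [abs_neg, abs_of_nonneg (div_nonneg (pow_nonneg hρ.1.le _)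
      (pow_nonneg (hR.le.trans hRψ) _))]
    exact div_le_one_of_le₀ (pow_le_pow_left₀ hρ.1.le (hρ.2.le.trans hRψ) _)
      (pow_nonneg (hR.le.trans hRψ) _)
  · rw [deriv_zero_of_not_differentiableAt, abs_zero]
    · exact abs_nonneg _
    intro hout
    have hrr := reflect_reflect hd hρ.1.le hpow.le
    have hψpow : reflect d R ρ ^ d < 2 * R ^ d := by
      rw [reflect_pow hd hpow.le]
      linarith [pow_pos hρ.1 d]
    have hψ' := hasDerivAt_reflect hd hψpow
    refine hdiff ?_
    rw [← hrr] at hout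
    refine ((hout.comp _ hψ'.differentiableAt).const_sub (F R)).congr_of_eventuallyEq ?_
    have h1 : ∀ᶠ σ in nhds (reflect d R ρ), reflect d R σ ∈ Ioo 0 R ∩ Ioi b := by
      refine hψ'.continuousAt.eventually_mem ?_
      rw [hrr]
      exact inter_mem (Ioo_mem_nhds hρ.1 hρ.2) (Ioi_mem_nhds hρb)
    have h2 : ∀ᶠ σ in nhds (reflect d R ρ), σ ^ d < 2 * R ^ d :=
      (continuous_pow d).continuousAt.eventually_lt_const hψpow
    have h3 : ∀ᶠ σ in nhds (reflect d R ρ), 0 < σ := Ioi_mem_nhds (hR.trans_le hRψ)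
    filter_upwards [h1, h2, h3] with σ h1 h2 h3
    rw [Function.comp_apply, heq _ h1.1 h1.2, reflect_reflect hd h3.le h2.le, sub_sub_cancel]

theorem abs_deriv_le (hF : LipschitzWith K F) (ρ : ℝ) : |deriv F ρ| ≤ K :=
  norm_deriv_le_of_lipschitz hF

theorem integrableOn_pow_mul_deriv_sq (hF : LipschitzWith K F) (x y : ℝ) :
    IntegrableOn (fun ρ => ρ ^ (d - 1) * deriv F ρ ^ 2) (Ioo x y) := by
  refine integrableOn_pow_mul (C := (K : ℝ) ^ 2) ((measurable_deriv F).pow_const 2)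
    (fun ρ => ?_) x y
  rw [abs_pow]
  exact pow_le_pow_left₀ (abs_nonneg _) (abs_deriv_le hF ρ) 2

theorem integrableOn_pow_mul_of_continuous {H : ℝ → ℝ} (hH : Continuous H) (x y : ℝ) :
    IntegrableOn (fun ρ => ρ ^ (d - 1) * H ρ) (Ioo x y) :=
  (((continuous_pow _).mul hH).continuousOn.integrableOn_Icc).mono_set Ioo_subset_Icc_self

theorem integral_deriv_sq_innerPart_add_outerPart_le (hd : 0 < d) (hR : 0 < R)
    (hF : LipschitzWith K F) (hG : LipschitzWith K' G) (hb : 0 ≤ b) (hbR : b ≤ R)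
    (hFa : ∀ ρ, a ≤ ρ → F ρ = 0) (hGb : ∀ ρ, b ≤ ρ → G ρ = 0)
    (hab : a ^ d + b ^ d ≤ 2 * R ^ d) :
    (∫ ρ in Ioi 0, ρ ^ (d - 1) * deriv (innerPart R F) ρ ^ 2) +
        ∫ ρ in Ioi 0, ρ ^ (d - 1) * deriv (outerPart d R F G) ρ ^ 2 ≤
      (∫ ρ in Ioi 0, ρ ^ (d - 1) * deriv F ρ ^ 2) +
        ∫ ρ in Ioi 0, ρ ^ (d - 1) * deriv G ρ ^ 2 := by
  have haS : a ≤ reflect d R 0 :=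
    le_reflect hd hR le_rfl hR.le (by rw [zero_pow hd.ne']; linarith [pow_nonneg hb d])
  have hF' : ∀ ρ, reflect d R 0 < ρ → deriv F ρ ^ 2 = 0 := fun ρ h => by
    rw [deriv_eq_zero_of_forall_le hFa (haS.trans_lt h)]; simp
  have hG' : ∀ ρ, R < ρ → deriv G ρ ^ 2 = 0 := fun ρ h => by
    rw [deriv_eq_zero_of_forall_le hGb (hbR.trans_lt h)]; simp
  have hi' : ∀ ρ, R < ρ → deriv (innerPart R F) ρ ^ 2 = 0 := fun ρ h => by
    rw [deriv_eq_zero_of_forall_le (fun ρ h => innerPart_eq_zero h) h]; simp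
  have ho' : ∀ ρ, R < ρ → deriv (outerPart d R F G) ρ ^ 2 = 0 := fun ρ h => by
    rw [deriv_eq_zero_of_forall_le (fun ρ h => outerPart_eq_zero hd hR hbR hGb h) h]; simp
  obtain ⟨L, hL⟩ := lipschitzWith_outerPart hd hR hF hG
  have hFi := integrableOn_pow_mul_deriv_sq (d := d) hF
  have hFr := integrableOn_reflect (H := fun ρ => deriv F ρ ^ 2) hd hR (hFi _ _)
  have hGi := integrableOn_pow_mul_deriv_sq (d := d) hG 0 R
  rw [setIntegral_Ioi_eq_add (g := fun ρ => deriv F ρ ^ 2) hd hR hF' (hFi _ _) (hFi _ _),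
    setIntegral_Ioi_eq_Ioo hG', setIntegral_Ioi_eq_Ioo hi', setIntegral_Ioi_eq_Ioo ho', add_assoc,
    ← integral_add hFr hGi]
  refine add_le_add (le_of_eq ?_) ?_
  · exact setIntegral_congr_fun measurableSet_Ioo fun ρ hρ => by
      rw [(innerPart_eventuallyEq hρ.2).deriv_eq, deriv_sub_const]
  · refine integral_mono_ae (integrableOn_pow_mul_deriv_sq hL 0 R) (hFr.add hGi) ?_
    have hb0 : ∀ᵐ ρ : ℝ, ρ ≠ b := by simp [ae_iff]
    filter_upwards [ae_restrict_mem measurableSet_Ioo, ae_restrict_of_ae hb0] with ρ hρ hρb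
    have hw : 0 ≤ ρ ^ (d - 1) := pow_nonneg hρ.1.le _
    rw [← mul_add]
    refine mul_le_mul_of_nonneg_left ?_ hw
    rcases lt_or_gt_of_ne hρb with h | h
    · rw [deriv_outerPart_of_lt hd hR hFa hab hρ h]
      nlinarith [sq_nonneg (deriv F (reflect d R ρ))]
    · have := sq_le_sq.2 (abs_deriv_outerPart_le_of_gt (F := F) hd hR hGb hρ h)
      nlinarith [sq_nonneg (deriv G ρ)]

theorem integral_sq_add_le_integral_sq_innerPart_add_outerPart (hd : 0 < d) (hR : 0 < R)
    (hF : LipschitzWith K F) (hG : LipschitzWith K' G) (hb : 0 ≤ b) (hbR : b ≤ R)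
    (hFa : ∀ ρ, a ≤ ρ → F ρ = 0) (hGb : ∀ ρ, b ≤ ρ → G ρ = 0)
    (hab : a ^ d + b ^ d ≤ 2 * R ^ d)
    (hFG : ∫ ρ in Ioi 0, ρ ^ (d - 1) * F ρ = ∫ ρ in Ioi 0, ρ ^ (d - 1) * G ρ) :
    (∫ ρ in Ioi 0, ρ ^ (d - 1) * F ρ ^ 2) + ∫ ρ in Ioi 0, ρ ^ (d - 1) * G ρ ^ 2 ≤
      (∫ ρ in Ioi 0, ρ ^ (d - 1) * innerPart R F ρ ^ 2) +
        ∫ ρ in Ioi 0, ρ ^ (d - 1) * outerPart d R F G ρ ^ 2 := by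
  have haS : a ≤ reflect d R 0 :=
    le_reflect hd hR le_rfl hR.le (by rw [zero_pow hd.ne']; linarith [pow_nonneg hb d])
  have hF0 : ∀ ρ, reflect d R 0 < ρ → F ρ = 0 := fun ρ h => hFa _ (haS.trans h.le)
  have hG0 : ∀ ρ, R < ρ → G ρ = 0 := fun ρ h => hGb _ (hbR.trans h.le)
  obtain ⟨L, hL⟩ := lipschitzWith_outerPart hd hR hF hG
  have hF1 := integrableOn_pow_mul_of_continuous (d := d) hF.continuous
  have hF2 : ∀ x y, IntegrableOn (fun ρ => ρ ^ (d - 1) * F ρ ^ 2) (Ioo x y) :=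
    integrableOn_pow_mul_of_continuous (d := d) (hF.continuous.pow 2)
  have hF1r := integrableOn_reflect (H := F) hd hR (hF1 _ _)
  have hF2r := integrableOn_reflect (H := fun ρ => F ρ ^ 2) hd hR (hF2 _ _)
  have hG1 := integrableOn_pow_mul_of_continuous (d := d) hG.continuous 0 R
  have hG2 : IntegrableOn (fun ρ => ρ ^ (d - 1) * G ρ ^ 2) (Ioo 0 R) :=
    integrableOn_pow_mul_of_continuous (d := d) (hG.continuous.pow 2) 0 R
  have hi2 : IntegrableOn (fun ρ => ρ ^ (d - 1) * innerPart R F ρ ^ 2) (Ioo 0 R) :=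
    integrableOn_pow_mul_of_continuous (d := d)
    ((lipschitzWith_innerPart (R := R) hF).continuous.pow 2) 0 R
  have ho2 : IntegrableOn (fun ρ => ρ ^ (d - 1) * outerPart d R F G ρ ^ 2) (Ioo 0 R) :=
    integrableOn_pow_mul_of_continuous (d := d) (hL.continuous.pow 2) 0 R
  rw [setIntegral_Ioi_eq_add hd hR hF0 (hF1 _ _) (hF1 _ _), setIntegral_Ioi_eq_Ioo hG0] at hFG
  rw [setIntegral_Ioi_eq_add (g := fun ρ => F ρ ^ 2) hd hR (fun ρ h => by simp [hF0 ρ h])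
      (hF2 _ _) (hF2 _ _),
    setIntegral_Ioi_eq_Ioo (R := R) (g := fun ρ => G ρ ^ 2) (fun ρ h => by simp [hG0 ρ h]),
    setIntegral_Ioi_eq_Ioo (R := R) (g := fun ρ => innerPart R F ρ ^ 2)
      (fun ρ h => by simp [innerPart_eq_zero h.le]),
    setIntegral_Ioi_eq_Ioo (R := R) (g := fun ρ => outerPart d R F G ρ ^ 2)
      (fun ρ h => by simp [outerPart_eq_zero hd hR hbR hGb h.le])]
  have hzero : (2 * F R) * ((∫ ρ in Ioo 0 R, ρ ^ (d - 1) * F ρ) +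
      (∫ ρ in Ioo 0 R, ρ ^ (d - 1) * F (reflect d R ρ)) -
        ∫ ρ in Ioo 0 R, ρ ^ (d - 1) * G ρ) = 0 := by
    rw [hFG, sub_self, mul_zero]
  have hsum1 : IntegrableOn (fun ρ => ρ ^ (d - 1) * F ρ + ρ ^ (d - 1) * F (reflect d R ρ))
      (Ioo 0 R) := (hF1 _ _).add hF1r
  have hlin : IntegrableOn (fun ρ => 2 * F R * (ρ ^ (d - 1) * F ρ +
      ρ ^ (d - 1) * F (reflect d R ρ) - ρ ^ (d - 1) * G ρ)) (Ioo 0 R) :=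
    (hsum1.sub hG1).const_mul _
  have hsum2 : IntegrableOn (fun ρ => ρ ^ (d - 1) * F ρ ^ 2 +
      ρ ^ (d - 1) * F (reflect d R ρ) ^ 2) (Ioo 0 R) := (hF2 _ _).add hF2r
  have hquad : IntegrableOn (fun ρ => ρ ^ (d - 1) * F ρ ^ 2 +
      ρ ^ (d - 1) * F (reflect d R ρ) ^ 2 + ρ ^ (d - 1) * G ρ ^ 2) (Ioo 0 R) := hsum2.add hG2
  rw [← integral_add (hF1 _ _) hF1r, ← integral_sub hsum1 hG1, ← integral_const_mul] at hzero
  rw [← integral_add hi2 ho2, ← integral_add (hF2 _ _) hF2r, ← integral_add hsum2 hG2]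
  refine le_of_eq_of_le ((integral_sub hquad hlin).trans (by rw [hzero, sub_zero])).symm ?_
  refine setIntegral_mono_on (hquad.sub hlin) (hi2.add ho2) measurableSet_Ioo fun ρ hρ => ?_
  have hw : 0 ≤ ρ ^ (d - 1) := pow_nonneg hρ.1.le _
  rw [outerPart_eq hρ, innerPart, min_eq_left hρ.2.le]
  have hprod : F (reflect d R ρ) * G ρ = 0 := by
    rcases le_total ρ b with h | h
    · rw [apply_reflect_eq_zero hd hR hFa hab hρ.1.le hρ.2.le h, zero_mul]
    · rw [hGb ρ h, mul_zero]
  have : ρ ^ (d - 1) * (F ρ - F R) ^ 2 + ρ ^ (d - 1) * (F R - F (reflect d R ρ) + G ρ) ^ 2 -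
      (ρ ^ (d - 1) * F ρ ^ 2 + ρ ^ (d - 1) * F (reflect d R ρ) ^ 2 + ρ ^ (d - 1) * G ρ ^ 2 -
      2 * F R * (ρ ^ (d - 1) * F ρ + ρ ^ (d - 1) * F (reflect d R ρ) - ρ ^ (d - 1) * G ρ)) =
      2 * (ρ ^ (d - 1) * F R ^ 2) - 2 * ρ ^ (d - 1) * (F (reflect d R ρ) * G ρ) := by
    ring
  rw [hprod] at this
  have h2 := mul_nonneg hw (sq_nonneg (F R))
  linarith

end OneDimensional

section Gradient

variable {E : Type*} [NormedAddCommGroup E] [InnerProductSpace ℝ E] [CompleteSpace E]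

theorem norm_gradient_eq_norm_fderiv (u : E → ℝ) (x : E) :
    ‖gradient u x‖ = ‖fderiv ℝ u x‖ := by
  simp [gradient]

theorem norm_gradient_comp_norm (f : ℝ → ℝ) {x : E} (hx : x ≠ 0) :
    ‖gradient (fun y => f ‖y‖) x‖ = |deriv f ‖x‖| := by
  have hn : DifferentiableAt ℝ (fun y : E => ‖y‖) x :=
    (contDiffAt_norm ℝ hx).differentiableAt one_ne_zero
  have hx' : ‖x‖ ≠ 0 := norm_ne_zero_iff.2 hx
  have : Nontrivial E := ⟨x, 0, hx⟩
  rw [norm_gradient_eq_norm_fderiv]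
  by_cases hf : DifferentiableAt ℝ f ‖x‖
  · have h : HasFDerivAt (fun y => f ‖y‖) _ x := hf.hasDerivAt.comp_hasFDerivAt x hn.hasFDerivAt
    rw [h.fderiv, norm_smul, norm_fderiv_norm hn, mul_one, Real.norm_eq_abs]
  · rw [deriv_zero_of_not_differentiableAt hf, fderiv_zero_of_not_differentiableAt]
    · simp
    intro h
    have hline : DifferentiableAt ℝ (fun t : ℝ => (t / ‖x‖) • x) ‖x‖ := by fun_prop
    have hend : (‖x‖ / ‖x‖) • x = x := by rw [div_self hx', one_smul]
    refine hf (((hend.symm ▸ h).comp ‖x‖ hline).congr_of_eventuallyEq ?_)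
    filter_upwards [Ioi_mem_nhds (norm_pos_iff.2 hx)] with t ht
    have ht' : (0 : ℝ) < t := ht
    rw [Function.comp_apply, norm_smul, norm_div, norm_norm, div_mul_cancel₀ _ hx',
      Real.norm_of_nonneg ht'.le]

theorem norm_gradient_comp_norm_sub (f : ℝ → ℝ) (s : ℝ) {c x : E} (hx : x ≠ c) :
    ‖gradient (fun y => f (s * ‖y - c‖)) x‖ = |s * deriv f (s * ‖x - c‖)| := by
  have h := norm_gradient_comp_norm (fun t => f (s * t)) (sub_ne_zero.2 hx)
  rw [norm_gradient_eq_norm_fderiv] at h ⊢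
  rw [fderiv_comp_sub (f := fun y : E => f (s * ‖y‖)), h, deriv_comp_mul_left, smul_eq_mul]

end Gradient

section TestFunction

variable {d : ℕ}

variable {K : NNReal} {L : ℝ} {u : EuclideanSpace ℝ (Fin d) → ℝ}

theorem LipschitzWith.integrable_norm_gradient_sq (hu : LipschitzWith K u)
    (hL : ∀ x, L < ‖x‖ → u x = 0) : Integrable fun x => ‖gradient u x‖ ^ 2 := by
  have h2 : Integrable
      ((closedBall (0 : EuclideanSpace ℝ (Fin d)) L).indicator fun _ => (K : ℝ) ^ 2) := by
    refine (integrableOn_const ?_).integrable_indicator measurableSet_closedBall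
    exact measure_closedBall_lt_top.ne
  refine h2.mono' ?_ (ae_of_all _ fun x => ?_)
  · simp_rw [norm_gradient_eq_norm_fderiv]
    exact ((measurable_fderiv ℝ u).norm.pow_const 2).aestronglyMeasurable
  · rw [norm_pow, norm_norm]
    by_cases hx : x ∈ closedBall (0 : EuclideanSpace ℝ (Fin d)) L
    · rw [indicator_of_mem hx]
      exact pow_le_pow_left₀ (norm_nonneg _) (hu.norm_gradient_le x) 2
    · rw [indicator_of_notMem hx]
      have : u =ᶠ[nhds x] fun _ => 0 := by
        filter_upwards [isClosed_closedBall.isOpen_compl.mem_nhds hx] with y hy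
        exact hL y (by simpa using hy)
      rw [norm_gradient_eq_norm_fderiv, this.fderiv_eq]
      simp

theorem integral_comp_norm_sub (h : ℝ → ℝ) {s : ℝ} (hs : 0 < s) (c : EuclideanSpace ℝ (Fin d)) :
    ∫ x : EuclideanSpace ℝ (Fin d), h (s * ‖x - c‖) =
      (s ^ d)⁻¹ * ∫ x : EuclideanSpace ℝ (Fin d), h ‖x‖ := by
  rw [integral_sub_right_eq_self (fun x : EuclideanSpace ℝ (Fin d) => h (s * ‖x‖)) c]
  have := Measure.integral_comp_smul (volume : Measure (EuclideanSpace ℝ (Fin d)))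
    (fun x => h ‖x‖) s
  simp_rw [norm_smul, Real.norm_of_nonneg hs.le] at this
  rw [this, finrank_euclideanSpace_fin, smul_eq_mul, abs_of_pos (by positivity)]

theorem integral_norm_gradient_comp_norm_sub (hd : 0 < d) (f : ℝ → ℝ) {s : ℝ}
    (hs : 0 < s) (c : EuclideanSpace ℝ (Fin d)) :
    ∫ x : EuclideanSpace ℝ (Fin d), ‖gradient (fun y => f (s * ‖y - c‖)) x‖ ^ 2 =
      (s ^ d)⁻¹ * (s ^ 2 * ∫ x : EuclideanSpace ℝ (Fin d), deriv f ‖x‖ ^ 2) := by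
  have : NeZero d := ⟨hd.ne'⟩
  have hc : ∀ᵐ x : EuclideanSpace ℝ (Fin d), x ≠ c := by simp [ae_iff]
  rw [← integral_const_mul, ← integral_comp_norm_sub (fun t => s ^ 2 * deriv f t ^ 2) hs c]
  refine integral_congr_ae ?_
  filter_upwards [hc] with x hx
  rw [norm_gradient_comp_norm_sub f s hx, sq_abs, mul_pow]

/-- Upper bound for the twisted eigenvalue of two balls by means of radial functions. -/
theorem twistedEV_two_balls_mul_le (hd : 0 < d) {c₁ c₂ : EuclideanSpace ℝ (Fin d)} {r R : ℝ}
    (hr : 0 < r) (hR : 0 < R)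
    (hdisj : Disjoint (ball c₁ r) (ball c₂ r)) {f : ℝ → ℝ} (hf : LipschitzWith K f)
    (hfR : ∀ ρ, R ≤ ρ → f ρ = 0) :
    twistedEV d (ball c₁ r ∪ ball c₂ r) (fun _ => 1) * ∫ x : EuclideanSpace ℝ (Fin d), f ‖x‖ ^ 2 ≤
      (R / r) ^ 2 * ∫ x : EuclideanSpace ℝ (Fin d), deriv f ‖x‖ ^ 2 := by
  have : NeZero d := ⟨hd.ne'⟩
  set s := R / r with hs_def
  have hs : 0 < s := div_pos hR hr
  have hsr : s * r = R := div_mul_cancel₀ _ hr.ne'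
  set A := ∫ x : EuclideanSpace ℝ (Fin d), f ‖x‖ ^ 2 with hA
  set D := ∫ x : EuclideanSpace ℝ (Fin d), deriv f ‖x‖ ^ 2 with hD
  have hD0 : 0 ≤ D := integral_nonneg fun x => sq_nonneg _
  have hA0 : 0 ≤ A := integral_nonneg fun x => sq_nonneg _
  rcases hA0.eq_or_lt with hA' | hA'
  · rw [← hA', mul_zero]
    positivity
  let U : EuclideanSpace ℝ (Fin d) → EuclideanSpace ℝ (Fin d) → ℝ := fun c x => f (s * ‖x - c‖)
  have hU : ∀ c, LipschitzWith (K * (‖s‖₊ * (1 * 1))) (U c) := fun c =>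
    hf.comp ((lipschitzWith_smul s).comp (lipschitzWith_one_norm.comp
      (IsometryEquiv.subRight c).isometry.lipschitz))
  have hU0 : ∀ c x, x ∉ ball c r → U c x = 0 := fun c x hx => by
    rw [mem_ball_iff_norm, not_lt] at hx
    exact hfR _ (by rw [← hsr]; gcongr)
  have hUL : ∀ c x, ‖c‖ + r < ‖x‖ → U c x = 0 := fun c x hx => hU0 c x fun h => by
    rw [mem_ball_iff_norm] at h
    linarith [norm_sub_norm_le x c]
  have hUi := fun c => (hU c).integrable_of_eq_zero (hUL c)
  have hUi2 : ∀ c, Integrable fun x => U c x ^ 2 := fun c => by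
    obtain ⟨M, hM⟩ := (hU c).exists_bound (hUL c)
    simp_rw [pow_two]
    exact (hUi c).bdd_mul (hU c).continuous.aestronglyMeasurable (ae_of_all _ hM.2)
  have hmul : ∀ x, U c₁ x * U c₂ x = 0 := fun x => by
    by_cases hx : x ∈ ball c₁ r
    · rw [hU0 c₂ x (disjoint_left.1 hdisj hx), mul_zero]
    · rw [hU0 c₁ x hx, zero_mul]
  have hsq : ∫ x, (U c₁ x - U c₂ x) ^ 2 = 2 * (s ^ d)⁻¹ * A := by
    have : ∀ x, (U c₁ x - U c₂ x) ^ 2 = U c₁ x ^ 2 + U c₂ x ^ 2 := fun x => by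
      linear_combination -2 * hmul x
    simp_rw [this]
    rw [integral_add (hUi2 _) (hUi2 _), integral_comp_norm_sub (fun t => f t ^ 2) hs,
      integral_comp_norm_sub (fun t => f t ^ 2) hs]
    ring
  have hev : ∀ c x, x ∉ closedBall c r → U c =ᶠ[nhds x] fun _ => 0 := fun c x hx => by
    filter_upwards [isClosed_closedBall.isOpen_compl.mem_nhds hx] with y hy
    exact hU0 c y fun h => hy (ball_subset_closedBall h)
  have hgrad : ∫ x, ‖gradient (fun x => U c₁ x - U c₂ x) x‖ ^ 2 =
      2 * (s ^ d)⁻¹ * (s ^ 2 * D) := by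
    have : ∀ᵐ x, ‖gradient (fun x => U c₁ x - U c₂ x) x‖ ^ 2 =
        ‖gradient (U c₁) x‖ ^ 2 + ‖gradient (U c₂) x‖ ^ 2 := by
      have hsph : ∀ c : EuclideanSpace ℝ (Fin d), ∀ᵐ x, x ∉ sphere c r := fun c =>
        measure_eq_zero_iff_ae_notMem.1 (Measure.addHaar_sphere _ _ _)
      have hball : ∀ c c' : EuclideanSpace ℝ (Fin d),
          Disjoint (ball c r) (ball c' r) → ∀ x ∈ ball c r,
          U c' =ᶠ[nhds x] fun _ => 0 := fun c c' h x hx => by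
        filter_upwards [isOpen_ball.mem_nhds hx] with y hy
        exact hU0 c' y (disjoint_left.1 h hy)
      simp_rw [norm_gradient_eq_norm_fderiv]
      filter_upwards [hsph c₁, hsph c₂] with x h1 h2
      have key : U c₁ =ᶠ[nhds x] (fun _ => 0) ∨ U c₂ =ᶠ[nhds x] (fun _ => 0) := by
        by_cases hx : x ∈ closedBall c₁ r
        · rw [← ball_union_sphere] at hx
          exact Or.inr (hball c₁ c₂ hdisj x (hx.resolve_right h1))
        · exact Or.inl (hev c₁ x hx)
      rcases key with h | h
      · have h' : (fun x => U c₁ x - U c₂ x) =ᶠ[nhds x] fun x => -U c₂ x := by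
          filter_upwards [h] with y hy
          rw [hy, zero_sub]
        rw [h'.fderiv_eq, h.fderiv_eq, fderiv_fun_neg]
        simp
      · have h' : (fun x => U c₁ x - U c₂ x) =ᶠ[nhds x] U c₁ := by
          filter_upwards [h] with y hy
          rw [hy, sub_zero]
        rw [h'.fderiv_eq, h.fderiv_eq]
        simp
    rw [integral_congr_ae this, integral_add ((hU c₁).integrable_norm_gradient_sq (hUL c₁))
      ((hU c₂).integrable_norm_gradient_sq (hUL c₂)),
      integral_norm_gradient_comp_norm_sub hd f hs, integral_norm_gradient_comp_norm_sub hd f hs]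
    ring
  have hmem : rayleigh d (fun x => U c₁ x - U c₂ x) = s ^ 2 * D / A := by
    rw [rayleigh, hgrad, hsq]
    field_simp
  have hle : twistedEV d (ball c₁ r ∪ ball c₂ r) (fun _ => 1) ≤ s ^ 2 * D / A := by
    refine csInf_le ⟨0, ?_⟩ ⟨_, ⟨⟨_, (hU c₁).sub (hU c₂)⟩, ?_, ?_⟩, ?_, hmem⟩
    · rintro _ ⟨u, -, -, rfl⟩
      exact div_nonneg (integral_nonneg fun x => sq_nonneg _) (integral_nonneg fun x => sq_nonneg _)
    · intro x hx
      rw [mem_union, not_or] at hx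
      rw [hU0 c₁ x hx.1, hU0 c₂ x hx.2, sub_zero]
    · intro h
      have : ∫ x, (U c₁ x - U c₂ x) ^ 2 = 0 :=
        integral_eq_zero_of_ae (h.mono fun x hx => by simp only at hx; simp [hx])
      rw [hsq] at this
      exact absurd this (by positivity)
    · simp_rw [mul_one]
      rw [integral_sub (hUi _) (hUi _), integral_comp_norm_sub f hs, integral_comp_norm_sub f hs,
        sub_self]
  rwa [le_div_iff₀ hA'] at hle

end TestFunction

section Comparison

variable {d : ℕ} {R Λ M L : ℝ} {K K' : NNReal} {u v w : EuclideanSpace ℝ (Fin d) → ℝ}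

theorem integral_comp_norm_eq (d : ℕ) [NeZero d] (H : ℝ → ℝ) :
    ∫ x : EuclideanSpace ℝ (Fin d), H ‖x‖ =
      d * volume.real (ball (0 : EuclideanSpace ℝ (Fin d)) 1) *
        ∫ ρ in Ioi (0 : ℝ), ρ ^ (d - 1) * H ρ := by
  have := integral_fun_norm_addHaar (volume : Measure (EuclideanSpace ℝ (Fin d))) H
  simpa [finrank_euclideanSpace_fin, mul_assoc] using this

theorem add_pow_le_of_volume_ball_add_le (hd : 0 < d) {a b : ℝ} (ha : 0 ≤ a) (hb : 0 ≤ b)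
    (hR : 0 < R)
    (h : volume (ball (0 : EuclideanSpace ℝ (Fin d)) a) +
      volume (ball (0 : EuclideanSpace ℝ (Fin d)) b) ≤
      2 * volume (ball (0 : EuclideanSpace ℝ (Fin d)) R)) :
    a ^ d + b ^ d ≤ 2 * R ^ d := by
  have hω0 : volume (ball (0 : EuclideanSpace ℝ (Fin d)) 1) ≠ 0 :=
    (measure_ball_pos _ _ one_pos).ne'
  have hωt : volume (ball (0 : EuclideanSpace ℝ (Fin d)) 1) ≠ ∞ := measure_ball_lt_top.ne
  rw [volume_ball_zero_eq hd a, volume_ball_zero_eq hd b, volume_ball_zero_eq hd R, ← add_mul,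
    ← mul_assoc, ENNReal.mul_le_mul_iff_left hω0 hωt, ← ENNReal.ofReal_pow ha,
    ← ENNReal.ofReal_pow hb, ← ENNReal.ofReal_pow hR.le,
    ← ENNReal.ofReal_add (by positivity) (by positivity), ← ENNReal.ofReal_ofNat 2,
    ← ENNReal.ofReal_mul (by norm_num), ENNReal.ofReal_le_ofReal_iff (by positivity)] at h
  exact h

theorem mul_integral_sq_add_le (hd : 0 < d) (hR : 0 < R) (hΛ : 0 ≤ Λ) (hM : 0 ≤ M)
    (hup : ∀ f : ℝ → ℝ, (∃ K, LipschitzWith K f) → (∀ ρ, R ≤ ρ → f ρ = 0) →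
      Λ * ∫ x : EuclideanSpace ℝ (Fin d), f ‖x‖ ^ 2 ≤
        M * ∫ x : EuclideanSpace ℝ (Fin d), deriv f ‖x‖ ^ 2)
    (hv : LipschitzWith K v) (hvL : ∀ x, L < ‖x‖ → v x = 0) (hv0 : ∀ x, 0 ≤ v x)
    (hw : LipschitzWith K' w) (hwL : ∀ x, L < ‖x‖ → w x = 0) (hw0 : ∀ x, 0 ≤ w x)
    (hvol : volume {x | 0 < v x} + volume {x | 0 < w x} ≤
      2 * volume (ball (0 : EuclideanSpace ℝ (Fin d)) R))
    (hwv : volume {x | 0 < w x} ≤ volume {x | 0 < v x}) (hint : ∫ x, v x = ∫ x, w x) :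
    Λ * ((∫ x, v x ^ 2) + ∫ x, w x ^ 2) ≤
      M * ((∫ x, ‖gradient v x‖ ^ 2) + ∫ x, ‖gradient w x‖ ^ 2) := by
  have : NeZero d := ⟨hd.ne'⟩
  obtain ⟨a, ha, hva⟩ := exists_volume_ball_zero_eq hd (volume_lt_ne_top hvL le_rfl)
  obtain ⟨b, hb, hwb⟩ := exists_volume_ball_zero_eq hd (volume_lt_ne_top hwL le_rfl)
  rw [← hva, ← hwb] at hvol
  have hab := add_pow_le_of_volume_ball_add_le hd ha hb hR hvol
  have hba : b ≤ a := by
    by_contra! h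
    rw [← hva, ← hwb] at hwv
    exact absurd hwv (not_le.2 (volume_ball_zero_strictMono hd h (ha.trans_lt h)))
  have hbR : b ≤ R := by
    refine le_of_pow_le_pow_left₀ hd.ne' hR.le ?_
    linarith [pow_le_pow_left₀ hb hba d]
  set F := rearr v with hFdef
  set G := rearr w with hGdef
  have hF : LipschitzWith K F := LipschitzWith.rearr hd hv hvL
  have hG : LipschitzWith K' G := LipschitzWith.rearr hd hw hwL
  have hFa : ∀ ρ, a ≤ ρ → F ρ = 0 := fun ρ h =>
    rearr_eq_zero hv hvL (hva.ge.trans (measure_mono (ball_subset_ball h)))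
  have hGb : ∀ ρ, b ≤ ρ → G ρ = 0 := fun ρ h =>
    rearr_eq_zero hw hwL (hwb.ge.trans (measure_mono (ball_subset_ball h)))
  have hκ : 0 < d * volume.real (ball (0 : EuclideanSpace ℝ (Fin d)) 1) :=
    mul_pos (by exact_mod_cast hd) (ENNReal.toReal_pos (measure_ball_pos _ _ one_pos).ne'
      measure_ball_lt_top.ne)
  have hF1 : ∫ x : EuclideanSpace ℝ (Fin d), F ‖x‖ = ∫ x, v x := by
    simpa using integral_rearr_norm_rpow hd hv hvL hv0 one_pos
  have hG1 : ∫ x : EuclideanSpace ℝ (Fin d), G ‖x‖ = ∫ x, w x := by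
    simpa using integral_rearr_norm_rpow hd hw hwL hw0 one_pos
  have hF2 : ∫ x : EuclideanSpace ℝ (Fin d), F ‖x‖ ^ 2 = ∫ x, v x ^ 2 := by
    exact_mod_cast integral_rearr_norm_rpow hd hv hvL hv0 two_pos
  have hG2 : ∫ x : EuclideanSpace ℝ (Fin d), G ‖x‖ ^ 2 = ∫ x, w x ^ 2 := by
    exact_mod_cast integral_rearr_norm_rpow hd hw hwL hw0 two_pos
  have hx0 : ∀ᵐ x : EuclideanSpace ℝ (Fin d), x ≠ 0 := by simp [ae_iff]
  have hgrad : ∀ f : ℝ → ℝ, ∫ x : EuclideanSpace ℝ (Fin d), ‖gradient (fun x => f ‖x‖) x‖ ^ 2 =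
      ∫ x : EuclideanSpace ℝ (Fin d), deriv f ‖x‖ ^ 2 := fun f => integral_congr_ae <| by
    filter_upwards [hx0] with x hx
    rw [norm_gradient_comp_norm f hx, sq_abs]
  have hFD : ∫ x : EuclideanSpace ℝ (Fin d), deriv F ‖x‖ ^ 2 ≤ ∫ x, ‖gradient v x‖ ^ 2 :=
    (hgrad F).symm.trans_le (integral_norm_gradient_rearr_le hd hv hvL hv0)
  have hGD : ∫ x : EuclideanSpace ℝ (Fin d), deriv G ‖x‖ ^ 2 ≤ ∫ x, ‖gradient w x‖ ^ 2 :=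
    (hgrad G).symm.trans_le (integral_norm_gradient_rearr_le hd hw hwL hw0)
  have hi := hup (innerPart R F) ⟨_, lipschitzWith_innerPart hF⟩ fun ρ h => innerPart_eq_zero h
  have ho := hup (outerPart d R F G) (lipschitzWith_outerPart hd hR hF hG)
    fun ρ h => outerPart_eq_zero hd hR hbR hGb h
  rw [← hF1, ← hG1, integral_comp_norm_eq d F, integral_comp_norm_eq d G,
    mul_right_inj' hκ.ne'] at hint
  have h1 := mul_le_mul_of_nonneg_left (integral_sq_add_le_integral_sq_innerPart_add_outerPart
    hd hR hF hG hb hbR hFa hGb hab hint) hκ.le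
  have h2 := mul_le_mul_of_nonneg_left (integral_deriv_sq_innerPart_add_outerPart_le
    hd hR hF hG hb hbR hFa hGb hab) hκ.le
  simp only [mul_add, ← integral_comp_norm_eq d (fun ρ => F ρ ^ 2),
    ← integral_comp_norm_eq d (fun ρ => G ρ ^ 2),
    ← integral_comp_norm_eq d (fun ρ => innerPart R F ρ ^ 2),
    ← integral_comp_norm_eq d (fun ρ => outerPart d R F G ρ ^ 2)] at h1
  simp only [mul_add, ← integral_comp_norm_eq d (fun ρ => deriv F ρ ^ 2),
    ← integral_comp_norm_eq d (fun ρ => deriv G ρ ^ 2),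
    ← integral_comp_norm_eq d (fun ρ => deriv (innerPart R F) ρ ^ 2),
    ← integral_comp_norm_eq d (fun ρ => deriv (outerPart d R F G) ρ ^ 2)] at h2
  rw [← hF2, ← hG2]
  calc _ ≤ _ := mul_le_mul_of_nonneg_left h1 hΛ
    _ ≤ M * (_ + _) := by rw [mul_add, mul_add]; exact add_le_add hi ho
    _ ≤ _ := mul_le_mul_of_nonneg_left (h2.trans (add_le_add hFD hGD)) hM

theorem norm_gradient_posPart_sq_add_le (u : EuclideanSpace ℝ (Fin d) → ℝ) (hu : Continuous u)
    (x : EuclideanSpace ℝ (Fin d)) :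
    ‖gradient (fun x => max (u x) 0) x‖ ^ 2 + ‖gradient (fun x => max (-u x) 0) x‖ ^ 2 ≤
      ‖gradient u x‖ ^ 2 := by
  simp_rw [norm_gradient_eq_norm_fderiv]
  rcases lt_trichotomy (u x) 0 with h | h | h
  · have hev := hu.continuousAt.eventually_lt_const h
    have h1 : (fun x => max (u x) 0) =ᶠ[nhds x] fun _ => 0 :=
      hev.mono fun y hy => max_eq_right hy.le
    have h2 : (fun x => max (-u x) 0) =ᶠ[nhds x] fun x => -u x :=
      hev.mono fun y hy => max_eq_left (neg_nonneg.2 hy.le)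
    rw [h1.fderiv_eq, h2.fderiv_eq, fderiv_fun_neg]
    simp
  · have h1 : IsLocalMin (fun x => max (u x) 0) x :=
      Filter.Eventually.of_forall fun y => by simp [h]
    have h2 : IsLocalMin (fun x => max (-u x) 0) x :=
      Filter.Eventually.of_forall fun y => by simp [h]
    rw [h1.fderiv_eq_zero, h2.fderiv_eq_zero]
    simp
  · have hev := hu.continuousAt.eventually_const_lt h
    have h1 : (fun x => max (-u x) 0) =ᶠ[nhds x] fun _ => 0 :=
      hev.mono fun y hy => max_eq_right (neg_nonpos.2 (le_of_lt hy))
    have h2 : (fun x => max (u x) 0) =ᶠ[nhds x] u := hev.mono fun y hy => max_eq_left (le_of_lt hy)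
    rw [h1.fderiv_eq, h2.fderiv_eq]
    simp

theorem mul_integral_sq_le (hd : 0 < d) (hR : 0 < R) (hΛ : 0 ≤ Λ) (hM : 0 ≤ M)
    (hup : ∀ f : ℝ → ℝ, (∃ K, LipschitzWith K f) → (∀ ρ, R ≤ ρ → f ρ = 0) →
      Λ * ∫ x : EuclideanSpace ℝ (Fin d), f ‖x‖ ^ 2 ≤
        M * ∫ x : EuclideanSpace ℝ (Fin d), deriv f ‖x‖ ^ 2)
    (hu : LipschitzWith K u) (huL : ∀ x, L < ‖x‖ → u x = 0)
    (hvol : volume {x | u x ≠ 0} ≤ 2 * volume (ball (0 : EuclideanSpace ℝ (Fin d)) R))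
    (hint : ∫ x, u x = 0) :
    Λ * ∫ x, u x ^ 2 ≤ M * ∫ x, ‖gradient u x‖ ^ 2 := by
  have hv : LipschitzWith K fun x => max (u x) 0 := hu.max_const 0
  have hw : LipschitzWith K fun x => max (-u x) 0 := hu.neg.max_const 0
  have hvL : ∀ x, L < ‖x‖ → max (u x) 0 = 0 := fun x hx => by simp [huL x hx]
  have hwL : ∀ x, L < ‖x‖ → max (-u x) 0 = 0 := fun x hx => by simp [huL x hx]
  have hv0 : ∀ x, 0 ≤ max (u x) 0 := fun x => le_max_right _ _
  have hw0 : ∀ x, 0 ≤ max (-u x) 0 := fun x => le_max_right _ _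
  have hvol' : volume {x | 0 < max (u x) 0} + volume {x | 0 < max (-u x) 0} ≤
      2 * volume (ball (0 : EuclideanSpace ℝ (Fin d)) R) := by
    refine le_trans (le_of_eq ?_) hvol
    rw [← measure_union]
    · congr 1
      ext x
      simp [lt_or_lt_iff_ne, or_comm]
    · refine disjoint_left.2 fun x h1 h2 => ?_
      simp only [mem_ofPred_eq, lt_max_iff, lt_self_iff_false, or_false] at h1 h2
      linarith
    · exact (isOpen_lt continuous_const hw.continuous).measurableSet
  have hint' : ∫ x, max (u x) 0 = ∫ x, max (-u x) 0 := by
    rw [← sub_eq_zero, ← integral_sub (hv.integrable_of_eq_zero hvL) (hw.integrable_of_eq_zero hwL)]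
    refine Eq.trans ?_ hint
    refine integral_congr_ae (ae_of_all _ fun x => ?_)
    rcases le_total (u x) 0 with h | h
    · simp [h]
    · simp [h]
  have hsq : ∀ {z : EuclideanSpace ℝ (Fin d) → ℝ}, LipschitzWith K z → (∀ x, L < ‖x‖ → z x = 0) →
      Integrable fun x => z x ^ 2 := fun {z} hz hzL =>
    (hz.continuous.pow 2).integrable_of_hasCompactSupport
      (HasCompactSupport.intro (isCompact_closedBall 0 L) fun x hx => by
        have : z x = 0 := hzL x (by simpa using hx)
        simp [this])
  have hsum : (∫ x, max (u x) 0 ^ 2) + ∫ x, max (-u x) 0 ^ 2 = ∫ x, u x ^ 2 := by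
    rw [← integral_add (hsq hv hvL) (hsq hw hwL)]
    refine integral_congr_ae (ae_of_all _ fun x => ?_)
    rcases le_total (u x) 0 with h | h
    · simp [h]
    · simp [h]
  have hgrad : (∫ x, ‖gradient (fun x => max (u x) 0) x‖ ^ 2) +
      ∫ x, ‖gradient (fun x => max (-u x) 0) x‖ ^ 2 ≤ ∫ x, ‖gradient u x‖ ^ 2 := by
    have h1 := hv.integrable_norm_gradient_sq hvL
    have h2 := hw.integrable_norm_gradient_sq hwL
    rw [← integral_add h1 h2]
    exact integral_mono (h1.add h2) (hu.integrable_norm_gradient_sq huL)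
      (norm_gradient_posPart_sq_add_le u hu.continuous)
  rw [← hsum]
  refine le_trans ?_ (mul_le_mul_of_nonneg_left hgrad hM)
  rcases le_total (volume {x | 0 < max (-u x) 0}) (volume {x | 0 < max (u x) 0}) with h | h
  · exact mul_integral_sq_add_le hd hR hΛ hM hup hv hvL hv0 hw hwL hw0 hvol' h hint'
  · rw [add_comm] at hvol'
    rw [add_comm, add_comm (∫ x, ‖gradient (fun x => max (u x) 0) x‖ ^ 2)]
    exact mul_integral_sq_add_le hd hR hΛ hM hup hw hwL hw0 hv hvL hv0 hvol' h hint'.symm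

end Comparison

section TwistedEV

variable {d : ℕ} {Ω : Set (EuclideanSpace ℝ (Fin d))}

theorem rayleigh_nonneg (u : EuclideanSpace ℝ (Fin d) → ℝ) : 0 ≤ rayleigh d u :=
  div_nonneg (integral_nonneg fun _ => sq_nonneg _) (integral_nonneg fun _ => sq_nonneg _)

theorem twistedEV_nonneg (g : EuclideanSpace ℝ (Fin d) → ℝ) : 0 ≤ twistedEV d Ω g := by
  refine Real.sInf_nonneg ?_
  rintro _ ⟨u, -, -, rfl⟩
  exact rayleigh_nonneg u

theorem exists_isDirTrial_integral_eq_zero (hd : 0 < d) (hΩ : IsOpen Ω) (hΩn : Ω.Nonempty) :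
    ∃ u, IsDirTrial d Ω u ∧ ∫ x, u x * 1 = 0 := by
  have : NeZero d := ⟨hd.ne'⟩
  obtain ⟨x₀, hx₀⟩ := hΩn
  obtain ⟨ε, hε, hsub⟩ := Metric.isOpen_iff.1 hΩ x₀ hx₀
  obtain ⟨e, he⟩ := exists_norm_eq (EuclideanSpace ℝ (Fin d)) (half_pos hε).le
  obtain ⟨φ, K, hφ, hφ0, hφpos⟩ : ∃ (φ : EuclideanSpace ℝ (Fin d) → ℝ) (K : NNReal),
      LipschitzWith K φ ∧ (∀ x, ε / 2 ≤ ‖x‖ → φ x = 0) ∧ φ 0 ≠ 0 :=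
    ⟨fun x => max (ε / 2 - ‖x‖) 0, _,
      ((LipschitzWith.const (ε / 2)).sub lipschitzWith_one_norm).max_const 0,
      fun x h => max_eq_right (by linarith), by simpa using hε⟩
  have hlip : ∀ c, LipschitzWith (K * 1) fun x => φ (x - c) := fun c =>
    hφ.comp (IsometryEquiv.subRight c).isometry.lipschitz
  have hint : ∀ c, Integrable fun x => φ (x - c) := fun c =>
    (hlip c).integrable_of_eq_zero (L := ‖c‖ + ε / 2) fun x hx => hφ0 _ (by
      linarith [norm_sub_norm_le x c])
  have hout : ∀ c x, ‖c - x₀‖ = ε / 2 → x ∉ Ω → φ (x - c) = 0 := fun c x hc hx => hφ0 _ (by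
    by_contra! h
    refine hx (hsub ?_)
    rw [mem_ball_iff_norm]
    linarith [norm_sub_le_norm_sub_add_norm_sub x c x₀])
  have hcont : Continuous fun x => φ (x - (x₀ + e)) - φ (x - (x₀ - e)) :=
    (hlip _).continuous.sub (hlip _).continuous
  refine ⟨fun x => φ (x - (x₀ + e)) - φ (x - (x₀ - e)),
    ⟨⟨_, (hlip _).sub (hlip _)⟩, fun x hx => ?_, fun h => hφpos ?_⟩, ?_⟩
  · have h₁ := hout (x₀ + e) x (by rw [add_sub_cancel_left, he]) hx
    have h₂ := hout (x₀ - e) x (by rw [sub_sub_cancel_left, norm_neg, he]) hx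
    simp only [h₁, h₂, sub_zero]
  · have h0 := congrFun ((hcont.ae_eq_iff_eq volume continuous_const).1 h) (x₀ + e)
    have h2 : φ (x₀ + e - (x₀ - e)) = 0 := hφ0 _ (by
      rw [add_sub_sub_cancel, ← two_smul ℝ e, norm_smul, he, Real.norm_ofNat]
      linarith)
    simpa only [h2, sub_self, sub_zero] using h0
  · simp_rw [mul_one]
    rw [integral_sub (hint _) (hint _), integral_sub_right_eq_self φ,
      integral_sub_right_eq_self φ, sub_self]

theorem twistedEV_two_balls_div_le (hd : 0 < d) (hΩo : IsOpen Ω) (hΩb : Bornology.IsBounded Ω)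
    (hΩn : Ω.Nonempty) {c₁ c₂ : EuclideanSpace ℝ (Fin d)} {r R : ℝ} (hr : 0 < r) (hR : 0 < R)
    (hdisj : Disjoint (ball c₁ r) (ball c₂ r))
    (hvol : volume Ω ≤ 2 * volume (ball (0 : EuclideanSpace ℝ (Fin d)) R)) :
    twistedEV d (ball c₁ r ∪ ball c₂ r) (fun _ => 1) / (R / r) ^ 2 ≤
      twistedEV d Ω (fun _ => 1) := by
  obtain ⟨u₀, h₀, h₀'⟩ := exists_isDirTrial_integral_eq_zero hd hΩo hΩn
  refine le_csInf ⟨_, u₀, h₀, h₀', rfl⟩ ?_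
  rintro _ ⟨u, ⟨⟨K, hu⟩, huΩ, hune⟩, hint, rfl⟩
  obtain ⟨L, hL⟩ := hΩb.exists_norm_le
  have huL : ∀ x, L < ‖x‖ → u x = 0 := fun x hx => huΩ x fun h => absurd (hL x h) (not_le.2 hx)
  have husq : Integrable fun x => u x ^ 2 :=
    (hu.continuous.pow 2).integrable_of_hasCompactSupport
      (HasCompactSupport.intro (isCompact_closedBall 0 L) fun x hx => by
        have : u x = 0 := huL x (by simpa using hx)
        simp [this])
  have hpos : 0 < ∫ x, u x ^ 2 := by
    refine lt_of_le_of_ne (integral_nonneg fun x => sq_nonneg _) fun h => hune ?_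
    have h' := (integral_eq_zero_iff_of_nonneg (fun x => sq_nonneg (u x)) husq).1 h.symm
    exact h'.mono fun x hx => by simpa using hx
  have hsub : {x | u x ≠ 0} ⊆ Ω := fun x hx => by_contra fun h => hx (huΩ x h)
  have hRr : 0 < (R / r) ^ 2 := by positivity
  have key := mul_integral_sq_le hd hR (twistedEV_nonneg _) hRr.le
    (fun f ⟨_, hf⟩ hfR => twistedEV_two_balls_mul_le hd hr hR hdisj hf hfR) hu huL
    ((measure_mono hsub).trans hvol) (by simpa using hint)
  rw [rayleigh, div_le_div_iff₀ hRr hpos]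
  linarith

end TwistedEV

/-- Freitas–Henrot inequality: the scaled first standard twisted eigenvalue
is minimized by the union of two disjoint balls of equal radius. -/
theorem stmt15 (d : ℕ) (hd : 2 ≤ d) (Ω : Set (EuclideanSpace ℝ (Fin d)))
    (hΩo : IsOpen Ω) (hΩb : Bornology.IsBounded Ω) (hΩn : Ω.Nonempty)
    (c₁ c₂ : EuclideanSpace ℝ (Fin d)) (r : ℝ) (hr : 0 < r)
    (hdisj : Disjoint (ball c₁ r) (ball c₂ r)) :
    (volume (ball c₁ r ∪ ball c₂ r)).toReal ^ ((2 : ℝ) / d) *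
        twistedEV d (ball c₁ r ∪ ball c₂ r) (fun _ => 1) ≤
      (volume Ω).toReal ^ ((2 : ℝ) / d) * twistedEV d Ω (fun _ => 1) := by
  have hd0 : 0 < d := by omega
  have hΩtop : volume Ω ≠ ∞ := hΩb.measure_lt_top.ne
  obtain ⟨R, hR0, hR⟩ := exists_volume_ball_zero_eq hd0
    (ENNReal.div_ne_top hΩtop two_ne_zero : volume Ω / 2 ≠ ∞)
  have hΩR : volume Ω = 2 * volume (ball (0 : EuclideanSpace ℝ (Fin d)) R) := by
    rw [hR, ENNReal.mul_div_cancel two_ne_zero ENNReal.ofNat_ne_top]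
  have hRpos : 0 < R := by
    refine lt_of_le_of_ne hR0 fun h => (hΩo.measure_pos volume hΩn).ne' ?_
    rw [hΩR, ← h, ball_zero, measure_empty, mul_zero]
  have hballs : volume (ball c₁ r ∪ ball c₂ r) =
      2 * volume (ball (0 : EuclideanSpace ℝ (Fin d)) r) := by
    rw [measure_union hdisj measurableSet_ball, Measure.addHaar_ball_center volume c₁,
      Measure.addHaar_ball_center volume c₂, two_mul]
  have hpow : ∀ {t : ℝ}, 0 ≤ t →
      (2 * volume (ball (0 : EuclideanSpace ℝ (Fin d)) t)).toReal ^ ((2 : ℝ) / d) =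
        (2 * volume.real (ball (0 : EuclideanSpace ℝ (Fin d)) 1)) ^ ((2 : ℝ) / d) * t ^ 2 := by
    intro t ht
    have hdR : (d : ℝ) ≠ 0 := by exact_mod_cast hd0.ne'
    rw [volume_ball_zero_eq hd0, ENNReal.toReal_mul, ENNReal.toReal_mul, ENNReal.toReal_pow,
      ENNReal.toReal_ofReal ht, mul_left_comm, mul_comm (t ^ d), ENNReal.toReal_ofNat,
      Real.mul_rpow (by positivity) (by positivity), ← Real.rpow_natCast t d, ← Real.rpow_mul ht,
      mul_div_cancel₀ _ hdR, Real.rpow_ofNat]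
    rfl
  have h := twistedEV_two_balls_div_le hd0 hΩo hΩb hΩn hr hRpos hdisj hΩR.le
  rw [div_pow, div_div_eq_mul_div, div_le_iff₀ (by positivity)] at h
  rw [hballs, hΩR, hpow hr.le, hpow hR0, mul_assoc, mul_assoc]
  exact mul_le_mul_of_nonneg_left (by linarith) (by positivity)
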